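/- Let n ≥ 2 and let f : S^n → (0,∞) be a positive Lipschitz function, extended to ℝ^{n+1}\{0} as a function homogeneous of degree −1. Let u : ℝ^{n+1} → ℝ be continuous, homogeneous of degree 1, of class C² on ℝ^{n+1}\{0}, and satisfy Δu = f on ℝ^{n+1}\{0}. Then u is convex on ℝ^{n+1} if and only if for every x ∈ S^n and every unit vector ξ ∈ ℝ^{n+1} with ⟨ξ, x⟩ = 0, one has ∫_{ℝ^{n+1}} ( −⟨ξ, y⟩ · ⟨∇f(y), ξ⟩ ) / |x − y|^{n+1} dy ≥ 0, where the integral is a Lebesgue integral (∇f exists almost everywhere by Rademacher's theorem) and is absolutely convergent. -/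

import Mathlib

open MeasureTheory Metric Set
open scoped RealInnerProductSpace

/-- The Euclidean Laplacian of `u : ℝ^m → ℝ`, as the sum of second partial
derivatives along the standard coordinate directions. -/
noncomputable def laplacian {m : ℕ} (u : EuclideanSpace ℝ (Fin m) → ℝ)
    (x : EuclideanSpace ℝ (Fin m)) : ℝ :=
  ∑ i, fderiv ℝ (fun y => fderiv ℝ u y (EuclideanSpace.single i 1)) x (EuclideanSpace.single i 1)

/-! ### Integration by parts for functions that are locally Lipschitz away from the origin -/

section IntegrationByParts

open Filter Topology Module

lemma LocallyLipschitzOn.comp_of_mapsTo {α β γ : Type*} [PseudoEMetricSpace α]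
    [PseudoEMetricSpace β] [PseudoEMetricSpace γ] {f : β → γ} {g : α → β} {s : Set α} {t : Set β}
    (hf : LocallyLipschitzOn t f) (hg : LocallyLipschitzOn s g) (hst : MapsTo g s t) :
    LocallyLipschitzOn s (f ∘ g) := by
  intro x hx
  obtain ⟨Kg, a, ha, hga⟩ := hg hx
  obtain ⟨Kf, b, hb, hfb⟩ := hf (hst hx)
  have hgb : g ⁻¹' b ∈ 𝓝[s] x :=
    (hg.continuousOn x hx).tendsto_nhdsWithin hst hb
  exact ⟨Kf * Kg, a ∩ g ⁻¹' b, inter_mem ha hgb,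
    hfb.comp (hga.mono inter_subset_left) fun y hy => hy.2⟩

lemma LocallyLipschitzOn.mul_real {α : Type*} [PseudoEMetricSpace α] {f g : α → ℝ} {s : Set α}
    (hf : LocallyLipschitzOn s f) (hg : LocallyLipschitzOn s g) :
    LocallyLipschitzOn s fun x => f x * g x := by
  have hm : LocallyLipschitz fun p : ℝ × ℝ => p.1 * p.2 :=
    (contDiff_fst.mul contDiff_snd : ContDiff ℝ 1 fun p : ℝ × ℝ => p.1 * p.2).locallyLipschitz
  have hp : LocallyLipschitzOn s fun x => (f x, g x) := by
    intro x hx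
    obtain ⟨Kf, a, ha, hfa⟩ := hf hx
    obtain ⟨Kg, b, hb, hgb⟩ := hg hx
    exact ⟨max Kf Kg, a ∩ b, inter_mem ha hb,
      (hfa.mono inter_subset_left).prodMk (hgb.mono inter_subset_right)⟩
  exact (locallyLipschitzOn_univ.2 hm).comp_of_mapsTo hp (mapsTo_univ _ _)

/-- A locally Lipschitz function on the line which vanishes at infinity and whose derivative is
integrable has a derivative with zero integral. -/
lemma integral_deriv_eq_zero_of_locallyLipschitz {g : ℝ → ℝ} (hg : LocallyLipschitz g)
    (hint : Integrable (deriv g)) (hlim : Tendsto g (cocompact ℝ) (𝓝 0)) :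
    ∫ t, deriv g t = 0 := by
  have h1 : Tendsto (fun R : ℝ => ∫ t in (-R)..R, deriv g t) atTop (𝓝 (∫ t, deriv g t)) :=
    intervalIntegral_tendsto_integral hint tendsto_neg_atTop_atBot tendsto_id
  have h2 : ∀ R : ℝ, ∫ t in (-R)..R, deriv g t = g R - g (-R) := by
    intro R
    obtain ⟨K, hK⟩ := LocallyLipschitzOn.exists_lipschitzOnWith_of_compact
      (isCompact_uIcc (a := -R) (b := R)) (hg.locallyLipschitzOn)
    exact hK.absolutelyContinuousOnInterval.integral_deriv_eq_sub
  simp_rw [h2] at h1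
  rw [cocompact_eq_atBot_atTop, tendsto_sup] at hlim
  have h3 : Tendsto (fun R : ℝ => g R - g (-R)) atTop (𝓝 (0 - 0)) :=
    hlim.2.sub (hlim.1.comp tendsto_neg_atTop_atBot)
  rw [sub_zero] at h3
  exact tendsto_nhds_unique h1 h3

lemma integral_prod_deriv_eq_zero_of_locallyLipschitzOn {W : Type*} [NormedAddCommGroup W]
    [MeasurableSpace W] [BorelSpace W] {ν : Measure W} [SigmaFinite ν] [NullSingletonClass ν]
    {F : W × ℝ → ℝ} (hF : LocallyLipschitzOn {0}ᶜ F)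
    (hint : Integrable (fun p : W × ℝ => deriv (fun t => F (p.1, t)) p.2) (ν.prod volume))
    (hlim : Tendsto F (cocompact (W × ℝ)) (𝓝 0)) :
    ∫ p : W × ℝ, deriv (fun t => F (p.1, t)) p.2 ∂(ν.prod volume) = 0 := by
  rw [integral_prod _ hint]
  apply integral_eq_zero_of_ae
  have h0 : ∀ᵐ w ∂ν, w ≠ 0 := by
    simp [ae_iff, measure_singleton]
  filter_upwards [hint.prod_right_ae, h0] with w hw hw0
  refine integral_deriv_eq_zero_of_locallyLipschitz ?_ hw ?_
  · rw [← locallyLipschitzOn_univ]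
    refine hF.comp_of_mapsTo (g := fun t : ℝ => (w, t)) ?_ ?_
    · exact (LipschitzWith.prodMk_left w).locallyLipschitz.locallyLipschitzOn
    · intro t _ h
      exact hw0 (congrArg Prod.fst h)
  · have hiso : Isometry fun t : ℝ => (w, t) := fun a b => by simp [Prod.edist_eq]
    exact hlim.comp hiso.isClosedEmbedding.tendsto_cocompact

lemma LocallyLipschitzOn.ae_differentiableAt {E : Type*} [NormedAddCommGroup E] [NormedSpace ℝ E]
    [FiniteDimensional ℝ E] [MeasurableSpace E] [BorelSpace E] {μ : Measure E}
    [μ.IsAddHaarMeasure] {s : Set E} {F : E → ℝ} (hs : IsOpen s) (hF : LocallyLipschitzOn s F) :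
    ∀ᵐ x ∂μ, x ∈ s → DifferentiableAt ℝ F x := by
  have key : ∀ x ∈ s, ∃ t ∈ 𝓝[s] x, ∀ᵐ y ∂μ, y ∈ t → DifferentiableAt ℝ F y := by
    intro x hx
    obtain ⟨K, t, ht, hK⟩ := hF hx
    rw [hs.nhdsWithin_eq hx] at ht
    refine ⟨interior t, ?_, ?_⟩
    · rw [hs.nhdsWithin_eq hx]
      exact interior_mem_nhds.2 ht
    · filter_upwards [(hK.mono interior_subset).ae_differentiableWithinAt_of_mem (μ := μ)]
        with y hy hyt
      exact (hy hyt).differentiableAt (isOpen_interior.mem_nhds hyt)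
  have : μ (s ∩ {x | ¬ DifferentiableAt ℝ F x}) = 0 := by
    refine measure_null_of_locally_null _ fun x hx => ?_
    obtain ⟨t, ht, hae⟩ := key x hx.1
    refine ⟨t ∩ (s ∩ {x | ¬ DifferentiableAt ℝ F x}), ?_, ?_⟩
    · exact inter_mem (nhdsWithin_mono _ inter_subset_left ht) self_mem_nhdsWithin
    · refine measure_mono_null ?_ hae
      rintro y ⟨hy, -, hy'⟩ h
      exact hy' (h hy)
  refine measure_mono_null ?_ this
  intro x hx
  simpa using hx

/-- The integral of a directional derivative vanishes, for functions which are locally Lipschitz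
off the origin and tend to zero at infinity. -/
theorem integral_fderiv_apply_eq_zero {E : Type*} [NormedAddCommGroup E] [NormedSpace ℝ E]
    [FiniteDimensional ℝ E] [MeasurableSpace E] [BorelSpace E] {μ : Measure E}
    [μ.IsAddHaarMeasure] (hE : 2 ≤ finrank ℝ E) {F : E → ℝ} {v : E}
    (hF : LocallyLipschitzOn {0}ᶜ F) (hint : Integrable (fun x => fderiv ℝ F x v) μ)
    (hlim : Tendsto F (cocompact E) (𝓝 0)) :
    ∫ x, fderiv ℝ F x v ∂μ = 0 := by
  rcases eq_or_ne v 0 with rfl | hv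
  · simp
  have : Nontrivial E := nontrivial_iff.2 ⟨v, 0, hv⟩
  let n := finrank ℝ E
  have hn : 2 ≤ n := hE
  let W := Fin (n - 1) → ℝ
  have : Nonempty (Fin (n - 1)) := ⟨⟨0, by omega⟩⟩
  have : Nontrivial W := inferInstanceAs (Nontrivial (Fin (n - 1) → ℝ))
  obtain ⟨L, hL⟩ : ∃ L : E ≃L[ℝ] (W × ℝ), L v = (0, 1) := by
    have : finrank ℝ (W × ℝ) = n := by simpa [this, W] using Nat.sub_add_cancel finrank_pos
    have L₀ : E ≃L[ℝ] (W × ℝ) := (ContinuousLinearEquiv.ofFinrankEq this).symm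
    obtain ⟨M, hM⟩ : ∃ M : (W × ℝ) ≃L[ℝ] (W × ℝ), M (L₀ v) = (0, 1) := by
      apply SeparatingDual.exists_continuousLinearEquiv_apply_eq
      · simpa using hv
      · simp
    exact ⟨L₀.trans M, by simp [hM]⟩
  have hLv : L.symm (0, 1) = v := by rw [← hL]; simp
  have L_emb : MeasurableEmbedding L := L.toHomeomorph.measurableEmbedding
  let ρ := Measure.map L μ
  let ν : Measure W := Measure.addHaar
  have hρ : ρ = (Measure.addHaarScalarFactor ρ (ν.prod volume)) • ν.prod volume :=
    Measure.isAddLeftInvariant_eq_smul _ _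
  have hν : ν.prod volume = (Measure.addHaarScalarFactor (ν.prod volume) ρ) • ρ :=
    Measure.isAddLeftInvariant_eq_smul _ _
  have hae : (fun x => fderiv ℝ F x v) =ᵐ[μ]
      fun x => deriv (fun t => F (L.symm ((L x).1, t))) (L x).2 := by
    have h0 : ∀ᵐ x ∂μ, x ≠ 0 := by simp [ae_iff, measure_singleton]
    filter_upwards [hF.ae_differentiableAt (μ := μ) isOpen_compl_singleton, h0] with x hx hx0
    have hd : HasDerivAt (fun t : ℝ => L.symm ((L x).1, t)) v (L x).2 := by
      have h1 : HasDerivAt (fun t : ℝ => ((L x).1, t)) ((0 : W), (1 : ℝ)) (L x).2 :=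
        (hasDerivAt_const _ _).prodMk (hasDerivAt_id _)
      have := L.symm.hasFDerivAt.comp_hasDerivAt (L x).2 h1
      rw [← hLv]
      exact this
    have hx' : HasFDerivAt F (fderiv ℝ F x) (L.symm ((L x).1, (L x).2)) := by
      simpa using (hx hx0).hasFDerivAt
    exact (hx'.comp_hasDerivAt (L x).2 hd).deriv.symm
  rw [integral_congr_ae hae]
  rw [integrable_congr hae] at hint
  have hmap : ∫ x, deriv (fun t => F (L.symm ((L x).1, t))) (L x).2 ∂μ
      = ∫ p, deriv (fun t => F (L.symm (p.1, t))) p.2 ∂ρ :=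
    (L_emb.integral_map (μ := μ) (fun p : W × ℝ => deriv (fun t => F (L.symm (p.1, t))) p.2)).symm
  have hint' : Integrable (fun p : W × ℝ => deriv (fun t => F (L.symm (p.1, t))) p.2) ρ :=
    L_emb.integrable_map_iff.2 hint
  suffices h : ∫ p, deriv (fun t => (F ∘ L.symm) (p.1, t)) p.2 ∂(ν.prod volume) = 0 by
    rw [hmap, hρ, integral_smul_nnreal_measure]
    exact (congrArg _ h).trans (smul_zero _)
  apply integral_prod_deriv_eq_zero_of_locallyLipschitzOn
  · refine hF.comp_of_mapsTo (L.symm.lipschitz.locallyLipschitz.locallyLipschitzOn) ?_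
    intro p hp h
    exact hp (by simpa using h)
  · rw [hν]
    exact hint'.smul_measure_nnreal
  · exact hlim.comp L.symm.toHomeomorph.isClosedEmbedding.tendsto_cocompact

end IntegrationByParts

/-! ### Regularised kernels -/

section DecaySymbol

open Filter Topology Module

lemma regularised_norm_pos {E : Type*} [NormedAddCommGroup E] {x : E} {ε : ℝ} (hε : 0 < ε)
    (y : E) : 0 < ‖y - x‖ ^ 2 + ε ^ 2 := by positivity

variable {E : Type*} [NormedAddCommGroup E] [InnerProductSpace ℝ E]

/-- The algebra generated by linear functions of `y - x` and powers of `‖y - x‖ ^ 2 + ε ^ 2`,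
graded by the order of decay at infinity. -/
inductive DecaySymbol (x : E) (ε : ℝ) : ℝ → (E → ℝ) → Prop
  | zero (k : ℝ) : DecaySymbol x ε k (fun _ => 0)
  | const (c : ℝ) : DecaySymbol x ε 0 (fun _ => c)
  | inner (v : E) : DecaySymbol x ε (-1) (fun y => ⟪v, y - x⟫)
  | bracket (s : ℝ) : DecaySymbol x ε (2 * s) (fun y => (‖y - x‖ ^ 2 + ε ^ 2) ^ (-s))
  | add {k : ℝ} {A B : E → ℝ} : DecaySymbol x ε k A → DecaySymbol x ε k B →
      DecaySymbol x ε k (fun y => A y + B y)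
  | mul {k l : ℝ} {A B : E → ℝ} : DecaySymbol x ε k A → DecaySymbol x ε l B →
      DecaySymbol x ε (k + l) (fun y => A y * B y)

namespace DecaySymbol

variable {x : E} {ε : ℝ}

lemma cast {k l : ℝ} {A B : E → ℝ} (h : DecaySymbol x ε k A) (hk : k = l)
    (hA : ∀ y, A y = B y) : DecaySymbol x ε l B := by
  obtain rfl : A = B := funext hA
  exact hk ▸ h

lemma const_mul {k : ℝ} {A : E → ℝ} (c : ℝ) (h : DecaySymbol x ε k A) :
    DecaySymbol x ε k (fun y => c * A y) :=
  ((DecaySymbol.const c).mul h).cast (zero_add k) fun _ => rfl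

lemma contDiff {k : ℝ} {A : E → ℝ} (hε : 0 < ε) (h : DecaySymbol x ε k A) (m : ℕ) :
    ContDiff ℝ m A := by
  induction h with
  | zero k => exact contDiff_const
  | const c => exact contDiff_const
  | inner v => exact contDiff_const.inner ℝ (contDiff_id.sub contDiff_const)
  | bracket s =>
    refine ContDiff.rpow_const_of_ne ?_ fun y => (regularised_norm_pos hε y).ne'
    exact ((contDiff_id.sub contDiff_const).norm_sq ℝ).add contDiff_const
  | add _ _ hA hB => exact hA.add hB
  | mul _ _ hA hB => exact hA.mul hB

lemma differentiable {k : ℝ} {A : E → ℝ} (hε : 0 < ε) (h : DecaySymbol x ε k A) :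
    Differentiable ℝ A := (h.contDiff hε 1).differentiable one_ne_zero

lemma _root_.hasFDerivAt_regularised_norm_rpow (hε : 0 < ε) (s : ℝ) (x y : E) :
    HasFDerivAt (fun y => (‖y - x‖ ^ 2 + ε ^ 2) ^ (-s))
      ((-s * (‖y - x‖ ^ 2 + ε ^ 2) ^ (-s - 1)) • (2 • (innerSL ℝ (y - x)))) y := by
  have h1 : HasFDerivAt (fun y => ‖y - x‖ ^ 2 + ε ^ 2) (2 • (innerSL ℝ (y - x))) y := by
    have := ((hasFDerivAt_id y).sub_const x).norm_sq.add_const (ε ^ 2)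
    simpa using this
  exact h1.rpow_const (Or.inl (regularised_norm_pos hε y).ne')

lemma _root_.fderiv_regularised_norm_rpow (hε : 0 < ε) (s : ℝ) (x y v : E) :
    fderiv ℝ (fun y => (‖y - x‖ ^ 2 + ε ^ 2) ^ (-s)) y v
      = -(2 * s) * ⟪v, y - x⟫ * (‖y - x‖ ^ 2 + ε ^ 2) ^ (-(s + 1)) := by
  rw [(hasFDerivAt_regularised_norm_rpow hε s x y).fderiv]
  simp only [smul_apply, innerSL_apply_apply, smul_eq_mul, nsmul_eq_mul]
  rw [real_inner_comm, show -(s + 1) = -s - 1 by ring]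
  push_cast
  ring

lemma fderiv_apply {k : ℝ} {A : E → ℝ} (hε : 0 < ε) (h : DecaySymbol x ε k A) (v : E) :
    DecaySymbol x ε (k + 1) (fun y => fderiv ℝ A y v) := by
  induction h with
  | zero k => exact (DecaySymbol.zero (k + 1)).cast rfl fun y => by simp
  | const c => exact (DecaySymbol.zero (0 + 1)).cast rfl fun y => by simp
  | inner w =>
    refine (DecaySymbol.const ⟪w, v⟫).cast (by ring) fun y => ?_
    have : HasFDerivAt (fun y => ⟪w, y - x⟫) (innerSL ℝ w) y := by
      have := (innerSL ℝ w).hasFDerivAt.comp y ((hasFDerivAt_id y).sub_const x)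
      simpa using! this
    rw [this.fderiv, innerSL_apply_apply]
  | bracket s =>
    refine (((DecaySymbol.inner v).const_mul (-(2 * s))).mul
      (DecaySymbol.bracket (s + 1))).cast (by ring) fun y => ?_
    rw [fderiv_regularised_norm_rpow hε]
  | add hA hB ihA ihB =>
    refine (ihA.add ihB).cast rfl fun y => ?_
    rw [fderiv_fun_add (hA.differentiable hε y) (hB.differentiable hε y)]
    rfl
  | @mul k l A B hA hB ihA ihB =>
    refine ((hA.mul ihB).cast (l := k + l + 1) (by ring) fun _ => rfl).add
      ((ihA.mul hB).cast (by ring) fun _ => rfl) |>.cast rfl fun y => ?_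
    rw [fderiv_fun_mul (hA.differentiable hε y) (hB.differentiable hε y)]
    simp [mul_comm]

lemma exists_bound_bracket {k : ℝ} {A : E → ℝ} (hε : 0 < ε) (h : DecaySymbol x ε k A) :
    ∃ C, 0 ≤ C ∧ ∀ y, |A y| ≤ C * (‖y - x‖ ^ 2 + ε ^ 2) ^ (-k / 2) := by
  induction h with
  | zero k => exact ⟨0, le_rfl, fun y => by simp⟩
  | const c => exact ⟨|c|, abs_nonneg c, fun y => by simp⟩
  | inner v =>
    refine ⟨‖v‖, norm_nonneg v, fun y => (abs_real_inner_le_norm _ _).trans ?_⟩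
    gcongr
    rw [neg_neg, ← Real.sqrt_eq_rpow]
    exact Real.le_sqrt_of_sq_le (by nlinarith)
  | bracket s =>
    refine ⟨1, zero_le_one, fun y => ?_⟩
    rw [abs_of_nonneg (Real.rpow_nonneg (regularised_norm_pos hε y).le _), one_mul]
    exact le_of_eq (by congr 1; ring)
  | add _ _ hA hB =>
    obtain ⟨C, hC, hA⟩ := hA
    obtain ⟨C', hC', hB⟩ := hB
    refine ⟨C + C', add_nonneg hC hC', fun y => (abs_add_le _ _).trans ?_⟩
    rw [add_mul]
    exact add_le_add (hA y) (hB y)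
  | @mul k l A B _ _ hA hB =>
    obtain ⟨C, hC, hA⟩ := hA
    obtain ⟨C', hC', hB⟩ := hB
    refine ⟨C * C', mul_nonneg hC hC', fun y => ?_⟩
    rw [abs_mul, show -(k + l) / 2 = -k / 2 + -l / 2 by ring,
      Real.rpow_add (regularised_norm_pos hε y)]
    calc |A y| * |B y| ≤ _ := mul_le_mul (hA y) (hB y) (abs_nonneg _) ((abs_nonneg _).trans (hA y))
      _ = _ := by ring

lemma exists_bound {k : ℝ} {A : E → ℝ} (hε : 0 < ε) (h : DecaySymbol x ε k A) (hk : 0 ≤ k) :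
    ∃ C, 0 ≤ C ∧ ∀ y, |A y| ≤ C * (1 + ‖y‖) ^ (-k) := by
  obtain ⟨C, hC, hA⟩ := h.exists_bound_bracket hε
  set M := (1 + ‖x‖) / ε + 1 with hM
  have hM0 : 0 < M := by positivity
  refine ⟨C * M ^ k, by positivity, fun y => (hA y).trans ?_⟩
  rw [mul_assoc]
  gcongr
  have hr := regularised_norm_pos (x := x) hε y
  set q := Real.sqrt (‖y - x‖ ^ 2 + ε ^ 2) with hq
  have hq0 : 0 < q := Real.sqrt_pos.2 hr
  have hqr : (‖y - x‖ ^ 2 + ε ^ 2) ^ (-k / 2) = q ^ (-k) := by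
    rw [hq, Real.sqrt_eq_rpow, ← Real.rpow_mul hr.le]
    congr 1; ring
  have h1 : ε ≤ q := Real.le_sqrt_of_sq_le (by nlinarith [sq_nonneg ‖y - x‖])
  have h2 : ‖y - x‖ ≤ q := Real.le_sqrt_of_sq_le (by nlinarith [sq_nonneg ε])
  have h3 : 1 + ‖y‖ ≤ M * q := by
    have h4 : ‖y‖ ≤ ‖x‖ + ‖y - x‖ := by
      have := norm_add_le x (y - x)
      simpa using this
    have h5 : 1 + ‖x‖ ≤ (1 + ‖x‖) / ε * q := by
      rw [div_mul_eq_mul_div, le_div_iff₀ hε]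
      gcongr
    rw [hM, add_mul]
    linarith
  rw [hqr, Real.rpow_neg hq0.le, Real.rpow_neg (by positivity), ← div_eq_mul_inv,
    inv_eq_one_div, div_le_div_iff₀ (by positivity) (by positivity), one_mul,
    ← Real.mul_rpow hM0.le hq0.le]
  exact Real.rpow_le_rpow (by positivity) h3 hk

end DecaySymbol

end DecaySymbol

/-! ### Functions bounded by powers of the norm -/

section PowerBounds

open Filter Topology Module

/-- A function which is locally Lipschitz off the origin, of size `O(‖y‖ ^ d)` with derivative of
size `O(‖y‖ ^ (d - 1))`. -/
structure HasPowerBounds {E : Type*} [NormedAddCommGroup E] [NormedSpace ℝ E] (d : ℝ)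
    (B : E → ℝ) : Prop where
  locallyLipschitzOn : LocallyLipschitzOn {0}ᶜ B
  exists_bound : ∃ C, 0 ≤ C ∧ ∀ y, y ≠ 0 → |B y| ≤ C * ‖y‖ ^ d
  exists_fderiv_bound : ∃ C, 0 ≤ C ∧ ∀ y, y ≠ 0 → ∀ v, |fderiv ℝ B y v| ≤ C * ‖y‖ ^ (d - 1) * ‖v‖

lemma Real.rpow_le_two_rpow_abs_mul_one_add_rpow {r : ℝ} (hr : 1 ≤ r) (e : ℝ) :
    r ^ e ≤ 2 ^ |e| * (1 + r) ^ e := by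
  have hr0 : 0 < r := by linarith
  rcases le_total 0 e with he | he
  · calc r ^ e ≤ 1 * (1 + r) ^ e := by
          rw [one_mul]; exact Real.rpow_le_rpow hr0.le (by linarith) he
      _ ≤ _ := by gcongr; exact Real.one_le_rpow one_le_two (abs_nonneg e)
  · rw [abs_of_nonpos he, Real.rpow_neg two_pos.le, ← div_eq_inv_mul,
      ← Real.div_rpow (by positivity) two_pos.le]
    exact Real.rpow_le_rpow_of_nonpos (by positivity) (by linarith) he

/-- An integrable function dominating the kernels considered below. -/
noncomputable def radialMajorant (E : Type*) [NormedAddCommGroup E] [NormedSpace ℝ E] (y : E) : ℝ :=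
  (ball (0 : E) 1).indicator (fun y => ‖y‖ ^ (1 - finrank ℝ E : ℝ)) y
    + (1 + ‖y‖) ^ (-(finrank ℝ E + 1) : ℝ)

lemma radialMajorant_nonneg {E : Type*} [NormedAddCommGroup E] [NormedSpace ℝ E] (y : E) :
    0 ≤ radialMajorant E y :=
  add_nonneg (indicator_nonneg (fun _ _ => by positivity) _) (by positivity)

variable {E : Type*} [NormedAddCommGroup E] [NormedSpace ℝ E]

lemma rpow_mul_le_radialMajorant {e k : ℝ} (he : -2 ≤ e) (hE : 3 ≤ finrank ℝ E)
    (hk : finrank ℝ E + e + 1 = k) (y : E) (hy : y ≠ 0) :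
    (1 + ‖y‖) ^ (-k) * ‖y‖ ^ e ≤ 2 ^ |e| * radialMajorant E y := by
  have hE' : (3 : ℝ) ≤ finrank ℝ E := by exact_mod_cast hE
  have hy0 : 0 < ‖y‖ := norm_pos_iff.2 hy
  have h2 : (1 : ℝ) ≤ 2 ^ |e| := Real.one_le_rpow one_le_two (abs_nonneg e)
  rcases lt_or_ge ‖y‖ 1 with h | h
  · have h1 : (1 + ‖y‖) ^ (-k) ≤ 1 :=
      Real.rpow_le_one_of_one_le_of_nonpos (by linarith) (by linarith)
    calc (1 + ‖y‖) ^ (-k) * ‖y‖ ^ e ≤ 1 * ‖y‖ ^ (1 - finrank ℝ E : ℝ) := by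
          refine mul_le_mul h1 ?_ (by positivity) zero_le_one
          exact Real.rpow_le_rpow_of_exponent_ge hy0 h.le (by linarith)
      _ ≤ 1 * radialMajorant E y := by
          gcongr
          rw [radialMajorant, indicator_of_mem (by simpa using h)]
          linarith [show (0 : ℝ) ≤ (1 + ‖y‖) ^ (-(finrank ℝ E + 1) : ℝ) by positivity]
      _ ≤ _ := mul_le_mul_of_nonneg_right h2 (radialMajorant_nonneg y)
  · calc (1 + ‖y‖) ^ (-k) * ‖y‖ ^ e ≤ (1 + ‖y‖) ^ (-k) * (2 ^ |e| * (1 + ‖y‖) ^ e) := by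
          gcongr
          exact Real.rpow_le_two_rpow_abs_mul_one_add_rpow h e
      _ = 2 ^ |e| * (1 + ‖y‖) ^ (-(finrank ℝ E + 1) : ℝ) := by
          rw [mul_left_comm, ← Real.rpow_add (by positivity)]
          congr 2
          linarith
      _ ≤ _ := by
          gcongr
          rw [radialMajorant]
          linarith [indicator_nonneg (s := ball (0 : E) 1)
            (f := fun y => ‖y‖ ^ (1 - finrank ℝ E : ℝ)) (fun _ _ => by positivity) y]

variable [FiniteDimensional ℝ E] [MeasurableSpace E] [BorelSpace E] {μ : Measure E}
  [μ.IsAddHaarMeasure]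

lemma integrable_radialMajorant [Nontrivial E] : Integrable (radialMajorant E) μ := by
  refine Integrable.add ?_ (integrable_one_add_norm (by linarith))
  rw [integrable_indicator_iff measurableSet_ball,
    integrableOn_fun_norm_addHaar μ (f := fun r : ℝ => r ^ (1 - finrank ℝ E : ℝ))]
  have : IntegrableOn (fun _ : ℝ => (1 : ℝ)) (Ioo 0 1) := by simp
  refine this.congr_fun (fun r hr => ?_) measurableSet_Ioo
  have hE : 1 ≤ finrank ℝ E := finrank_pos
  have hr0 : 0 < r := hr.1
  rw [smul_eq_mul, ← Real.rpow_natCast, ← Real.rpow_add hr0, Nat.cast_sub hE]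
  simp

lemma integrable_mul_of_power_bounds (hE : 3 ≤ finrank ℝ E) {e k C C' : ℝ} {A B : E → ℝ}
    (he : -2 ≤ e) (hk : finrank ℝ E + e + 1 = k) (hA : AEStronglyMeasurable A μ)
    (hB : AEStronglyMeasurable B μ) (hC : 0 ≤ C)
    (hAb : ∀ y, |A y| ≤ C * (1 + ‖y‖) ^ (-k)) (hBb : ∀ y, y ≠ 0 → |B y| ≤ C' * ‖y‖ ^ e) :
    Integrable (fun y => A y * B y) μ := by
  have : Nontrivial E := nontrivial_of_finrank_pos (R := ℝ) (by omega)
  have hC' : 0 ≤ C' := by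
    obtain ⟨z, hz⟩ := exists_ne (0 : E)
    exact nonneg_of_mul_nonneg_left ((abs_nonneg _).trans (hBb z hz))
      (Real.rpow_pos_of_pos (norm_pos_iff.2 hz) e)
  have h0 : ∀ᵐ x ∂μ, x ≠ 0 := by simp [ae_iff, measure_singleton]
  refine Integrable.mono'
    ((integrable_radialMajorant (E := E) (μ := μ)).const_mul (C * C' * 2 ^ |e|))
    (hA.mul hB) ?_
  filter_upwards [h0] with y hy
  rw [Real.norm_eq_abs, abs_mul]
  calc |A y| * |B y| ≤ (C * (1 + ‖y‖) ^ (-k)) * (C' * ‖y‖ ^ e) :=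
        mul_le_mul (hAb y) (hBb y hy) (abs_nonneg _) (by positivity)
    _ = C * C' * ((1 + ‖y‖) ^ (-k) * ‖y‖ ^ e) := by ring
    _ ≤ C * C' * (2 ^ |e| * radialMajorant E y) := by
        exact mul_le_mul_of_nonneg_left (rpow_mul_le_radialMajorant he hE hk y hy) (by positivity)
    _ = _ := by ring

lemma LocallyLipschitzOn.aestronglyMeasurable_of_compl_singleton [Nontrivial E] {B : E → ℝ}
    (hB : LocallyLipschitzOn {0}ᶜ B) : AEStronglyMeasurable B μ := by
  have h := hB.continuousOn.aestronglyMeasurable (μ := μ) (measurableSet_singleton (0 : E)).compl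
  rwa [Measure.restrict_eq_self_of_ae_mem] at h
  simp [ae_iff, measure_singleton]

end PowerBounds

section KernelIntegrationByParts

open Filter Topology Module

variable {E : Type*} [NormedAddCommGroup E] [InnerProductSpace ℝ E] [FiniteDimensional ℝ E]
  [MeasurableSpace E] [BorelSpace E] {μ : Measure E} [μ.IsAddHaarMeasure] {x : E} {ε d : ℝ}
  {A B : E → ℝ}

lemma DecaySymbol.integrable_mul (hE : 3 ≤ finrank ℝ E) (hε : 0 < ε) {e : ℝ} (he : -2 ≤ e)
    (hA : DecaySymbol x ε (finrank ℝ E + e + 1) A) (hB : AEStronglyMeasurable B μ)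
    (hBb : ∃ C, ∀ y, y ≠ 0 → |B y| ≤ C * ‖y‖ ^ e) : Integrable (fun y => A y * B y) μ := by
  have hE' : (3 : ℝ) ≤ finrank ℝ E := by exact_mod_cast hE
  obtain ⟨C, hC, hAb⟩ := hA.exists_bound hε (by linarith)
  obtain ⟨C', hBb⟩ := hBb
  exact integrable_mul_of_power_bounds hE he rfl
    (hA.contDiff hε 0).continuous.aestronglyMeasurable hB hC hAb hBb

lemma DecaySymbol.integrable_mul_fderiv (hE : 3 ≤ finrank ℝ E) (hε : 0 < ε) (hd : -1 ≤ d)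
    (hA : DecaySymbol x ε (finrank ℝ E + d) A) (hB : HasPowerBounds d B) (v : E) :
    Integrable (fun y => A y * fderiv ℝ B y v) μ := by
  refine (hA.cast (l := finrank ℝ E + (d - 1) + 1) (by ring) fun _ => rfl).integrable_mul hE hε
    (by linarith) ?_ ?_
  · exact (measurable_fderiv_apply_const ℝ B v).aestronglyMeasurable
  · obtain ⟨C, -, hC⟩ := hB.exists_fderiv_bound
    exact ⟨C * ‖v‖, fun y hy => (hC y hy v).trans_eq (by ring)⟩

lemma DecaySymbol.integrable_fderiv_mul (hE : 3 ≤ finrank ℝ E) (hε : 0 < ε) (hd : -1 ≤ d)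
    (hA : DecaySymbol x ε (finrank ℝ E + d) A) (hB : HasPowerBounds d B) (v : E) :
    Integrable (fun y => fderiv ℝ A y v * B y) μ := by
  have : Nontrivial E := nontrivial_of_finrank_pos (R := ℝ) (by omega)
  refine (hA.fderiv_apply hε v).integrable_mul hE hε (by linarith) ?_ ?_
  · exact hB.locallyLipschitzOn.aestronglyMeasurable_of_compl_singleton
  · obtain ⟨C, -, hC⟩ := hB.exists_bound
    exact ⟨C, hC⟩

/-- Integration by parts against a regularised kernel, without boundary terms at the origin or at
infinity. -/
theorem DecaySymbol.integral_fderiv_mul_eq_neg (hE : 3 ≤ finrank ℝ E) (hε : 0 < ε) (hd : -1 ≤ d)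
    (hA : DecaySymbol x ε (finrank ℝ E + d) A) (hB : HasPowerBounds d B) (v : E) :
    ∫ y, fderiv ℝ A y v * B y ∂μ = -∫ y, A y * fderiv ℝ B y v ∂μ := by
  have hE' : (3 : ℝ) ≤ finrank ℝ E := by exact_mod_cast hE
  have : Nontrivial E := nontrivial_of_finrank_pos (R := ℝ) (by omega)
  have h1 := hA.integrable_mul_fderiv (μ := μ) hE hε hd hB v
  have h2 := hA.integrable_fderiv_mul (μ := μ) hE hε hd hB v
  have h0 : ∀ᵐ x ∂μ, x ≠ 0 := by simp [ae_iff, measure_singleton]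
  have hae : (fun y => fderiv ℝ (fun y => A y * B y) y v) =ᵐ[μ]
      fun y => fderiv ℝ A y v * B y + A y * fderiv ℝ B y v := by
    filter_upwards [hB.locallyLipschitzOn.ae_differentiableAt (μ := μ) isOpen_compl_singleton, h0]
      with y hy hy0
    rw [fderiv_fun_mul (hA.differentiable hε y) (hy hy0)]
    simp only [add_apply, smul_apply, smul_eq_mul]
    ring
  have hzero : ∫ y, fderiv ℝ (fun y => A y * B y) y v ∂μ = 0 := by
    refine integral_fderiv_apply_eq_zero (by omega) ?_ ((integrable_congr hae).2 (h2.add h1)) ?_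
    · exact LocallyLipschitzOn.mul_real
        ((hA.contDiff hε 1).locallyLipschitz.locallyLipschitzOn) hB.locallyLipschitzOn
    · obtain ⟨C, hC, hAb⟩ := hA.exists_bound hε (by linarith)
      obtain ⟨C', hC', hBb⟩ := hB.exists_bound
      have hlim : Tendsto (fun y : E => C * C' * 2 ^ |d| * (1 + ‖y‖) ^ (-(finrank ℝ E : ℝ)))
          (cocompact E) (𝓝 0) := by
        have h := (tendsto_rpow_neg_atTop (show (0 : ℝ) < finrank ℝ E by linarith)).comp
          (tendsto_atTop_add_const_left _ 1 (tendsto_norm_cocompact_atTop (E := E)))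
        simpa using! h.const_mul (C * C' * 2 ^ |d|)
      refine squeeze_zero_norm' ?_ hlim
      filter_upwards [(tendsto_norm_cocompact_atTop (E := E)).eventually_ge_atTop 1] with y hy
      have hy0 : y ≠ 0 := norm_pos_iff.1 (by linarith)
      rw [Real.norm_eq_abs, abs_mul]
      calc |A y| * |B y| ≤ (C * (1 + ‖y‖) ^ (-(finrank ℝ E + d))) * (C' * ‖y‖ ^ d) :=
            mul_le_mul (hAb y) (hBb y hy0) (abs_nonneg _) (by positivity)
        _ ≤ (C * (1 + ‖y‖) ^ (-(finrank ℝ E + d))) * (C' * (2 ^ |d| * (1 + ‖y‖) ^ d)) := by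
            gcongr
            exact Real.rpow_le_two_rpow_abs_mul_one_add_rpow hy d
        _ = C * C' * 2 ^ |d| * ((1 + ‖y‖) ^ (-(finrank ℝ E + d)) * (1 + ‖y‖) ^ d) := by ring
        _ = _ := by
            rw [← Real.rpow_add (by positivity)]
            congr 2
            ring
  rw [integral_congr_ae hae, integral_add h2 h1] at hzero
  linarith

end KernelIntegrationByParts

/-! ### Homogeneous functions -/

section Homogeneous

open Filter Topology Module

variable {E : Type*} [NormedAddCommGroup E] [NormedSpace ℝ E] {F : Type*} [NormedAddCommGroup F]
  [NormedSpace ℝ F]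

/-- Positive homogeneity of degree `d` off the origin. -/
def PosHomogeneous (d : ℝ) (B : E → F) : Prop :=
  ∀ t : ℝ, 0 < t → ∀ y : E, y ≠ 0 → B (t • y) = t ^ d • B y

lemma PosHomogeneous.eq_norm_rpow_smul {d : ℝ} {B : E → F} (hB : PosHomogeneous d B) {y : E}
    (hy : y ≠ 0) : B y = ‖y‖ ^ d • B (‖y‖⁻¹ • y) := by
  have hy0 : 0 < ‖y‖ := norm_pos_iff.2 hy
  rw [← hB ‖y‖ hy0 _ (smul_ne_zero (inv_ne_zero hy0.ne') hy), smul_inv_smul₀ hy0.ne']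

lemma PosHomogeneous.exists_bound [FiniteDimensional ℝ E] {d : ℝ} {B : E → F}
    (hB : PosHomogeneous d B) (hc : ContinuousOn B {0}ᶜ) :
    ∃ C, 0 ≤ C ∧ ∀ y, y ≠ 0 → ‖B y‖ ≤ C * ‖y‖ ^ d := by
  obtain ⟨C, hC⟩ := (isCompact_sphere (0 : E) 1).exists_bound_of_continuousOn
    (hc.mono fun y hy h => by
      rw [mem_singleton_iff] at h
      simp [h] at hy)
  refine ⟨max C 0, le_max_right _ _, fun y hy => ?_⟩
  have hy0 : 0 < ‖y‖ := norm_pos_iff.2 hy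
  rw [hB.eq_norm_rpow_smul hy, norm_smul, Real.norm_of_nonneg (by positivity), mul_comm]
  gcongr
  exact (hC _ (by simp [norm_smul, hy0.ne'])).trans (le_max_left _ _)

lemma PosHomogeneous.posHomogeneous_fderiv {d : ℝ} {B : E → F} (hB : PosHomogeneous d B)
    (hd : DifferentiableOn ℝ B {0}ᶜ) : PosHomogeneous (d - 1) (fderiv ℝ B) := by
  intro t ht y hy
  have hd' : ∀ z : E, z ≠ 0 → HasFDerivAt B (fderiv ℝ B z) z := fun z hz =>
    (hd.differentiableAt (isOpen_compl_singleton.mem_nhds hz)).hasFDerivAt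
  have h1 : HasFDerivAt (fun z => B (t • z)) (t • fderiv ℝ B (t • y)) y := by
    have := (hd' (t • y) (smul_ne_zero ht.ne' hy)).comp y ((hasFDerivAt_id y).const_smul t)
    convert! this using 1
    ext v
    simp
  have h2 : HasFDerivAt (fun z => B (t • z)) (t ^ d • fderiv ℝ B y) y := by
    refine ((hd' y hy).const_smul (t ^ d)).congr_of_eventuallyEq ?_
    filter_upwards [isOpen_compl_singleton.mem_nhds hy] with z hz
    exact hB t ht z hz
  have h3 := h1.unique h2
  rw [Real.rpow_sub_one ht.ne', div_eq_inv_mul, mul_smul, ← h3, inv_smul_smul₀ ht.ne']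

lemma PosHomogeneous.posHomogeneous_fderiv_apply {d : ℝ} {B : E → F} (hB : PosHomogeneous d B)
    (hd : DifferentiableOn ℝ B {0}ᶜ) (v : E) :
    PosHomogeneous (d - 1) fun y => fderiv ℝ B y v := fun t ht y hy => by
  simp only [hB.posHomogeneous_fderiv hd t ht y hy, smul_apply]

lemma ContDiffOn.fderiv_apply_compl_singleton {k m : ℕ} {B : E → F} (hB : ContDiffOn ℝ k B {0}ᶜ)
    (hm : m + 1 ≤ k) (v : E) : ContDiffOn ℝ m (fun y => fderiv ℝ B y v) {0}ᶜ :=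
  (hB.fderiv_of_isOpen isOpen_compl_singleton (by exact_mod_cast hm)).clm_apply contDiffOn_const

lemma PosHomogeneous.hasPowerBounds [FiniteDimensional ℝ E] {d : ℝ} {B : E → ℝ}
    (hB : PosHomogeneous d B) (hc : ContDiffOn ℝ 1 B {0}ᶜ) : HasPowerBounds d B where
  locallyLipschitzOn := fun y hy => by
    obtain ⟨K, t, ht, h⟩ :=
      (hc.contDiffAt (isOpen_compl_singleton.mem_nhds hy)).exists_lipschitzOnWith
    exact ⟨K, t, mem_nhdsWithin_of_mem_nhds ht, h⟩
  exists_bound := hB.exists_bound hc.continuousOn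
  exists_fderiv_bound := by
    obtain ⟨C, hC, h⟩ := (hB.posHomogeneous_fderiv (hc.differentiableOn one_ne_zero)).exists_bound
      (hc.continuousOn_fderiv_of_isOpen isOpen_compl_singleton le_rfl)
    refine ⟨C, hC, fun y hy v => ?_⟩
    rw [← Real.norm_eq_abs]
    exact ((fderiv ℝ B y).le_opNorm v).trans (by gcongr; exact h y hy)

lemma abs_sub_le_of_homogeneous_neg_one {f : E → ℝ} {K : NNReal} {M : ℝ}
    (hf : PosHomogeneous (-1) f) (hlip : LipschitzOnWith K f (sphere 0 1))
    (hM : ∀ y ∈ sphere (0 : E) 1, |f y| ≤ M) {y z : E} (hy : y ≠ 0) (hz : z ≠ 0) :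
    |f y - f z| ≤ (M + 2 * K) * ‖y - z‖ / (‖y‖ * ‖z‖) := by
  have hy0 : 0 < ‖y‖ := norm_pos_iff.2 hy
  have hz0 : 0 < ‖z‖ := norm_pos_iff.2 hz
  set a := ‖y‖⁻¹ • y with ha
  set b := ‖z‖⁻¹ • z with hb
  have has : a ∈ sphere (0 : E) 1 := by simp [ha, norm_smul, hy0.ne']
  have hbs : b ∈ sphere (0 : E) 1 := by simp [hb, norm_smul, hz0.ne']
  have hM0 : 0 ≤ M := (abs_nonneg _).trans (hM a has)
  have hnorm : |‖z‖ - ‖y‖| ≤ ‖y - z‖ := by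
    rw [norm_sub_rev]; exact abs_norm_sub_norm_le z y
  have hab : ‖a - b‖ ≤ 2 * ‖y - z‖ / ‖y‖ := by
    have h1 : ‖y‖ • (a - b) = (y - z) + (‖z‖ - ‖y‖) • b := by
      rw [smul_sub, ha, smul_inv_smul₀ hy0.ne', sub_smul, hb, smul_inv_smul₀ hz0.ne']
      abel
    have h2 : ‖y‖ * ‖a - b‖ ≤ 2 * ‖y - z‖ := by
      rw [← Real.norm_of_nonneg hy0.le, ← norm_smul, h1]
      refine (norm_add_le _ _).trans ?_
      rw [norm_smul, mem_sphere_zero_iff_norm.1 hbs, mul_one, Real.norm_eq_abs]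
      linarith
    rw [le_div_iff₀ hy0]
    linarith
  have hl : |f a - f b| ≤ K * ‖a - b‖ := by
    have := hlip.dist_le_mul a has b hbs
    rwa [Real.dist_eq, dist_eq_norm] at this
  have h3 : f y - f z = (‖y‖⁻¹ - ‖z‖⁻¹) * f a + ‖z‖⁻¹ * (f a - f b) := by
    rw [hf.eq_norm_rpow_smul hy, hf.eq_norm_rpow_smul hz, Real.rpow_neg_one, Real.rpow_neg_one,
      smul_eq_mul, smul_eq_mul]
    ring
  have h4 : |‖y‖⁻¹ - ‖z‖⁻¹| ≤ ‖y - z‖ / (‖y‖ * ‖z‖) := by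
    rw [inv_sub_inv hy0.ne' hz0.ne', abs_div, abs_of_pos (mul_pos hy0 hz0)]
    gcongr
  rw [h3]
  calc _ ≤ |‖y‖⁻¹ - ‖z‖⁻¹| * |f a| + ‖z‖⁻¹ * |f a - f b| := by
        refine (abs_add_le _ _).trans_eq ?_
        rw [abs_mul, abs_mul, abs_of_pos (inv_pos.2 hz0)]
    _ ≤ ‖y - z‖ / (‖y‖ * ‖z‖) * M + ‖z‖⁻¹ * (K * (2 * ‖y - z‖ / ‖y‖)) := by
        gcongr
        · exact hM a has
        · exact hl.trans (by gcongr)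
    _ = _ := by field_simp

lemma hasPowerBounds_of_homogeneous_neg_one [FiniteDimensional ℝ E] {f : E → ℝ} {K : NNReal}
    (hf : PosHomogeneous (-1) f) (hlip : LipschitzOnWith K f (sphere 0 1)) :
    HasPowerBounds (-1) f := by
  obtain ⟨M, hM⟩ := (isCompact_sphere (0 : E) 1).exists_bound_of_continuousOn hlip.continuousOn
  set C := max M 0 + 2 * K with hC
  have hC0 : 0 ≤ C := by positivity
  have key : ∀ y z : E, y ≠ 0 → z ≠ 0 → |f y - f z| ≤ C * ‖y - z‖ / (‖y‖ * ‖z‖) := fun y z hy hz =>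
    abs_sub_le_of_homogeneous_neg_one hf hlip
      (fun w hw => (hM w hw).trans (le_max_left _ _)) hy hz
  have hloc : LocallyLipschitzOn {0}ᶜ f := by
    intro y hy
    have hy0 : 0 < ‖y‖ := norm_pos_iff.2 hy
    refine ⟨Real.toNNReal (C / ((‖y‖ / 2) * (‖y‖ / 2))), {z | ‖y‖ / 2 < ‖z‖}, ?_, ?_⟩
    · exact mem_nhdsWithin_of_mem_nhds
        (continuous_norm.continuousAt.eventually (lt_mem_nhds (by linarith)))
    · refine LipschitzOnWith.of_dist_le_mul fun a ha b hb => ?_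
      rw [mem_ofPred_eq] at ha hb
      have ha0 : 0 < ‖a‖ := by linarith
      have hb0 : 0 < ‖b‖ := by linarith
      rw [Real.coe_toNNReal _ (by positivity), Real.dist_eq, dist_eq_norm, div_mul_eq_mul_div]
      refine (key a b (norm_pos_iff.1 ha0) (norm_pos_iff.1 hb0)).trans ?_
      gcongr
  refine ⟨hloc, hf.exists_bound hloc.continuousOn, 2 * C, by positivity, fun y hy v => ?_⟩
  have hy0 : 0 < ‖y‖ := norm_pos_iff.2 hy
  have hpow : ‖y‖ ^ ((-1 : ℝ) - 1) = (‖y‖ * ‖y‖)⁻¹ := by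
    rw [show (-1 : ℝ) - 1 = -(2 : ℕ) by norm_num, Real.rpow_neg hy0.le, Real.rpow_natCast, sq]
  have hnorm : ‖fderiv ℝ f y‖ ≤ 2 * C * ‖y‖ ^ ((-1 : ℝ) - 1) := by
    refine norm_fderiv_le_of_lip' ℝ (by positivity) ?_
    filter_upwards [continuous_norm.continuousAt.eventually
      (lt_mem_nhds (show ‖y‖ / 2 < ‖y‖ by linarith))] with z hz
    have hz0 : 0 < ‖z‖ := by linarith
    refine (key z y (norm_pos_iff.1 hz0) hy).trans ?_
    calc C * ‖z - y‖ / (‖z‖ * ‖y‖) ≤ C * ‖z - y‖ / (‖y‖ / 2 * ‖y‖) := by gcongr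
      _ = _ := by rw [hpow]; field_simp
  exact ((fderiv ℝ f y).le_opNorm v).trans (by gcongr)

end Homogeneous

/-! ### Green's identity -/

section Green

open Filter Topology Module

lemma fderiv_fderiv_apply_comm {E : Type*} [NormedAddCommGroup E] [NormedSpace ℝ E] {A : E → ℝ}
    {y : E} (hA : ContDiffAt ℝ 2 A y) (v w : E) :
    fderiv ℝ (fun z => fderiv ℝ A z v) y w = fderiv ℝ (fun z => fderiv ℝ A z w) y v := by
  have hd : DifferentiableAt ℝ (fderiv ℝ A) y :=
    (hA.fderiv_right (m := 1) (by norm_num)).differentiableAt one_ne_zero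
  have h : ∀ v w : E, fderiv ℝ (fun z => fderiv ℝ A z v) y w = fderiv ℝ (fderiv ℝ A) y w v := by
    intro v w
    rw [fderiv_clm_apply hd (differentiableAt_const v)]
    simp
  rw [h, h]
  exact (hA.isSymmSndFDerivAt (by simp)).eq w v

variable {n : ℕ} {x : EuclideanSpace ℝ (Fin (n + 1))} {ε : ℝ}

lemma contDiff_fderiv_apply {E : Type*} [NormedAddCommGroup E] [NormedSpace ℝ E] {A : E → ℝ}
    (hA : ∀ m : ℕ, ContDiff ℝ m A) (v : E) (m : ℕ) : ContDiff ℝ m fun y => fderiv ℝ A y v :=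
  ((hA (m + 1)).fderiv_right (by norm_cast)).clm_apply contDiff_const

lemma laplacian_fderiv_apply {A : EuclideanSpace ℝ (Fin n) → ℝ} (hA : ∀ m : ℕ, ContDiff ℝ m A)
    (v y : EuclideanSpace ℝ (Fin n)) :
    laplacian (fun z => fderiv ℝ A z v) y = fderiv ℝ (laplacian A) y v := by
  unfold laplacian
  rw [fderiv_fun_sum fun i _ => ((contDiff_fderiv_apply
    (contDiff_fderiv_apply hA _) _ 1).differentiable one_ne_zero) y]
  rw [sum_apply]
  refine Finset.sum_congr rfl fun i _ => ?_
  have h : (fun z => fderiv ℝ (fun y => fderiv ℝ A y v) z (EuclideanSpace.single i 1))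
      = fun z => fderiv ℝ (fun y => fderiv ℝ A y (EuclideanSpace.single i 1)) z v :=
    funext fun z => fderiv_fderiv_apply_comm (hA 2).contDiffAt _ _
  rw [h]
  exact fderiv_fderiv_apply_comm (contDiff_fderiv_apply hA _ 2).contDiffAt _ _

lemma DecaySymbol.laplacian {A : EuclideanSpace ℝ (Fin n) → ℝ} {x : EuclideanSpace ℝ (Fin n)}
    {k : ℝ} (hε : 0 < ε) (hA : DecaySymbol x ε k A) : DecaySymbol x ε (k + 2) (laplacian A) := by
  have : ∀ s : Finset (Fin n), DecaySymbol x ε (k + 2) (fun y => ∑ i ∈ s,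
      fderiv ℝ (fun z => fderiv ℝ A z (EuclideanSpace.single i 1)) y
        (EuclideanSpace.single i 1)) := by
    intro s
    induction s using Finset.induction_on with
    | empty => exact (DecaySymbol.zero _).cast rfl fun y => by simp
    | insert i s hi ih =>
      refine ((((hA.fderiv_apply hε (EuclideanSpace.single i 1)).fderiv_apply hε
        (EuclideanSpace.single i 1)).cast (by ring)
        fun _ => rfl).add ih).cast rfl fun y => ?_
      rw [Finset.sum_insert hi]
  exact this _

/-- The regularised fundamental solution of the Laplacian. -/
lemma laplacian_regularised_kernel (hε : 0 < ε) (x y : EuclideanSpace ℝ (Fin (n + 1))) :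
    laplacian (fun y => (‖y - x‖ ^ 2 + ε ^ 2) ^ (-((n - 1) / 2 : ℝ))) y
      = -((n - 1) * (n + 1) * (ε ^ 2 * (‖y - x‖ ^ 2 + ε ^ 2) ^ (-((n + 3) / 2 : ℝ)))) := by
  unfold laplacian
  have hr := regularised_norm_pos (x := x) hε y
  have key : ∀ i : Fin (n + 1), fderiv ℝ (fun z => fderiv ℝ
      (fun y => (‖y - x‖ ^ 2 + ε ^ 2) ^ (-((n - 1) / 2 : ℝ))) z (EuclideanSpace.single i 1)) y
      (EuclideanSpace.single i 1) = -(n - 1) * ((‖y - x‖ ^ 2 + ε ^ 2) ^ (-((n + 1) / 2 : ℝ))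
        - (n + 1) * (y - x) i ^ 2 * (‖y - x‖ ^ 2 + ε ^ 2) ^ (-((n + 3) / 2 : ℝ))) := by
    intro i
    set e : EuclideanSpace ℝ (Fin (n + 1)) := EuclideanSpace.single i 1 with he
    have h1 : (fun z => fderiv ℝ
        (fun y => (‖y - x‖ ^ 2 + ε ^ 2) ^ (-((n - 1) / 2 : ℝ))) z e)
        = fun z => (-(n - 1) * ⟪e, z - x⟫) * (‖z - x‖ ^ 2 + ε ^ 2) ^ (-((n + 1) / 2 : ℝ)) := by
      funext z
      rw [fderiv_regularised_norm_rpow hε]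
      ring_nf
    have h2 : HasFDerivAt (fun z => -(n - 1 : ℝ) * ⟪e, z - x⟫) (-(n - 1 : ℝ) • innerSL ℝ e) y := by
      have := ((innerSL ℝ e).hasFDerivAt.comp y ((hasFDerivAt_id y).sub_const x)).const_mul
        (-(n - 1 : ℝ))
      simpa using! this
    have h3 : ⟪e, y - x⟫ = (y - x) i := by
      rw [he, EuclideanSpace.inner_single_left]; simp
    have h4 : ⟪e, e⟫ = 1 := by simp [he]
    rw [h1, fderiv_fun_mul h2.differentiableAt
      (hasFDerivAt_regularised_norm_rpow hε _ x y).differentiableAt]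
    simp only [add_apply, smul_apply, smul_eq_mul]
    rw [fderiv_regularised_norm_rpow hε, h2.fderiv]
    simp only [smul_apply, innerSL_apply_apply, smul_eq_mul]
    rw [h3, h4]
    rw [show ((n : ℝ) + 1) / 2 + 1 = (n + 3) / 2 by ring]
    ring
  rw [Finset.sum_congr rfl fun i _ => key i, ← Finset.mul_sum, Finset.sum_sub_distrib,
    ← Finset.sum_mul, ← Finset.mul_sum]
  have hs : ∑ i, (y - x) i ^ 2 = ‖y - x‖ ^ 2 := by
    rw [EuclideanSpace.norm_sq_eq]; simp
  have hp : (‖y - x‖ ^ 2 + ε ^ 2) ^ (-((n + 1) / 2 : ℝ))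
      = (‖y - x‖ ^ 2 + ε ^ 2) * (‖y - x‖ ^ 2 + ε ^ 2) ^ (-((n + 3) / 2 : ℝ)) := by
    nth_rw 2 [← Real.rpow_one (‖y - x‖ ^ 2 + ε ^ 2)]
    rw [← Real.rpow_add hr]
    congr 1
    ring
  rw [hs, hp]
  simp only [Finset.sum_const, Finset.card_univ, Fintype.card_fin, nsmul_eq_mul]
  push_cast
  ring

variable {f u : EuclideanSpace ℝ (Fin (n + 1)) → ℝ}

/-- Green's second identity for a kernel decaying at infinity and a function which is homogeneous
of degree one. -/
lemma DecaySymbol.integral_mul_eq_integral_laplacian_mul (hn : 2 ≤ n) (hε : 0 < ε)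
    {Q : EuclideanSpace ℝ (Fin (n + 1)) → ℝ} (hQ : DecaySymbol x ε (n + 1) Q)
    (hu : HasPowerBounds 1 u) (hdu : ∀ v, HasPowerBounds 0 fun y => fderiv ℝ u y v)
    (hlap : ∀ y, y ≠ 0 → _root_.laplacian u y = f y) :
    ∫ y, Q y * f y = ∫ y, _root_.laplacian Q y * u y := by
  have hE : finrank ℝ (EuclideanSpace ℝ (Fin (n + 1))) = n + 1 := by simp
  have hE3 : 3 ≤ finrank ℝ (EuclideanSpace ℝ (Fin (n + 1))) := by omega
  have h0 : ∀ᵐ y : EuclideanSpace ℝ (Fin (n + 1)), y ≠ 0 := by simp [ae_iff, measure_singleton]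
  have hQ0 : DecaySymbol x ε (finrank ℝ (EuclideanSpace ℝ (Fin (n + 1))) + 0) Q :=
    hQ.cast (by rw [hE]; push_cast; ring) fun _ => rfl
  have hQ1 : ∀ v, DecaySymbol x ε (finrank ℝ (EuclideanSpace ℝ (Fin (n + 1))) + 1)
      fun y => fderiv ℝ Q y v := fun v =>
    (hQ0.fderiv_apply hε v).cast (by ring) fun _ => rfl
  calc ∫ y, Q y * f y = ∫ y, Q y * _root_.laplacian u y := by
        refine integral_congr_ae ?_
        filter_upwards [h0] with y hy
        rw [hlap y hy]
    _ = ∑ i, ∫ y, Q y * fderiv ℝ (fun y => fderiv ℝ u y (EuclideanSpace.single i 1)) y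
          (EuclideanSpace.single i 1) := by
        unfold _root_.laplacian
        simp_rw [Finset.mul_sum]
        exact integral_finsetSum _ fun i _ =>
          hQ0.integrable_mul_fderiv hE3 hε (by norm_num) (hdu _) _
    _ = ∑ i, ∫ y, fderiv ℝ (fun y => fderiv ℝ Q y (EuclideanSpace.single i 1)) y
          (EuclideanSpace.single i 1) * u y := by
        refine Finset.sum_congr rfl fun i _ => ?_
        rw [(hQ1 _).integral_fderiv_mul_eq_neg hE3 hε (by norm_num) hu,
          hQ0.integral_fderiv_mul_eq_neg hE3 hε (by norm_num) (hdu _), neg_neg]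
    _ = _ := by
        unfold _root_.laplacian
        simp_rw [Finset.sum_mul]
        exact (integral_finsetSum _ fun i _ =>
          (hQ1 _).integrable_fderiv_mul hE3 hε (by norm_num) hu _).symm

/-- The representation formula for second derivatives, against the regularised fundamental
solution. -/
theorem integral_regularised_kernel_mul_fderiv (hn : 2 ≤ n) (hε : 0 < ε)
    (x ξ : EuclideanSpace ℝ (Fin (n + 1)))
    (hu : HasPowerBounds 1 u) (hdu : ∀ v, HasPowerBounds 0 fun y => fderiv ℝ u y v)
    (hf : HasPowerBounds (-1) f) (hlap : ∀ y, y ≠ 0 → laplacian u y = f y) :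
    ∫ y, -⟪ξ, y - x⟫ * (‖y - x‖ ^ 2 + ε ^ 2) ^ (-((n + 1) / 2 : ℝ)) * fderiv ℝ f y ξ
      = (n + 1) * ∫ y, ε ^ 2 * (‖y - x‖ ^ 2 + ε ^ 2) ^ (-((n + 3) / 2 : ℝ)) *
          fderiv ℝ (fun z => fderiv ℝ u z ξ) y ξ := by
  have hE : finrank ℝ (EuclideanSpace ℝ (Fin (n + 1))) = n + 1 := by simp
  have hE3 : 3 ≤ finrank ℝ (EuclideanSpace ℝ (Fin (n + 1))) := by omega
  set G : EuclideanSpace ℝ (Fin (n + 1)) → ℝ :=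
    fun y => (‖y - x‖ ^ 2 + ε ^ 2) ^ (-((n - 1) / 2 : ℝ)) with hG
  have hGs : DecaySymbol x ε (n - 1) G := (DecaySymbol.bracket _).cast (by ring) fun _ => rfl
  have hGd : ∀ m : ℕ, ContDiff ℝ m G := hGs.contDiff hε
  have hP : DecaySymbol x ε n fun y => fderiv ℝ G y ξ :=
    (hGs.fderiv_apply hε ξ).cast (by ring) fun _ => rfl
  have hQ := hP.fderiv_apply hε ξ
  have hL : DecaySymbol x ε (n + 1) (laplacian G) :=
    (hGs.laplacian hε).cast (by ring) fun _ => rfl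
  have h1 := (hP.cast (l := finrank ℝ (EuclideanSpace ℝ (Fin (n + 1))) + (-1))
    (by rw [hE]; push_cast; ring) fun _ => rfl).integral_fderiv_mul_eq_neg (μ := volume) hE3 hε
    le_rfl hf ξ
  have h2 := hQ.integral_mul_eq_integral_laplacian_mul hn hε hu hdu hlap
  have h3 : laplacian (fun y => fderiv ℝ (fun z => fderiv ℝ G z ξ) y ξ)
      = fun y => fderiv ℝ (fun z => fderiv ℝ (laplacian G) z ξ) y ξ := by
    funext y
    rw [laplacian_fderiv_apply (contDiff_fderiv_apply hGd ξ)]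
    congr 2
    funext z
    exact laplacian_fderiv_apply hGd ξ z
  have hL0 := hL.cast (l := finrank ℝ (EuclideanSpace ℝ (Fin (n + 1))) + 0)
    (by rw [hE]; push_cast; ring) fun _ => rfl
  have hL1 := (hL.fderiv_apply hε ξ).cast (l := finrank ℝ (EuclideanSpace ℝ (Fin (n + 1))) + 1)
    (by rw [hE]; push_cast; ring) fun _ => rfl
  have h4 := hL1.integral_fderiv_mul_eq_neg (μ := volume) hE3 hε (by norm_num) hu ξ
  have h5 := hL0.integral_fderiv_mul_eq_neg (μ := volume) hE3 hε (by norm_num) (hdu ξ) ξ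
  rw [h3, h4, h5, neg_neg] at h2
  rw [h2] at h1
  have hn1 : (0 : ℝ) < n - 1 := by
    have : (2 : ℝ) ≤ n := by exact_mod_cast hn
    linarith
  have h6 : ∀ y, fderiv ℝ G y ξ = (n - 1) *
      (-⟪ξ, y - x⟫ * (‖y - x‖ ^ 2 + ε ^ 2) ^ (-((n + 1) / 2 : ℝ))) := by
    intro y
    rw [hG, fderiv_regularised_norm_rpow hε]
    ring_nf
  simp_rw [h6, hG, laplacian_regularised_kernel hε x] at h1
  have e1 : ∀ y, -((n - 1 : ℝ) * (n + 1) * (ε ^ 2 * (‖y - x‖ ^ 2 + ε ^ 2) ^ (-((n + 3) / 2 : ℝ)))) *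
        fderiv ℝ (fun z => fderiv ℝ u z ξ) y ξ
      = -((n - 1) * (n + 1)) * (ε ^ 2 * (‖y - x‖ ^ 2 + ε ^ 2) ^ (-((n + 3) / 2 : ℝ)) *
        fderiv ℝ (fun z => fderiv ℝ u z ξ) y ξ) := fun y => by ring
  have e2 : ∀ y, (n - 1 : ℝ) * (-⟪ξ, y - x⟫ * (‖y - x‖ ^ 2 + ε ^ 2) ^ (-((n + 1) / 2 : ℝ))) *
        fderiv ℝ f y ξ
      = (n - 1) * (-⟪ξ, y - x⟫ * (‖y - x‖ ^ 2 + ε ^ 2) ^ (-((n + 1) / 2 : ℝ)) *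
        fderiv ℝ f y ξ) := fun y => by ring
  simp_rw [e1, e2, integral_const_mul] at h1
  apply mul_left_cancel₀ hn1.ne'
  linarith

end Green

/-! ### Passing to the limit in the regularisation -/

section Limit

open Filter Topology Module

lemma tendsto_regularised_norm_rpow {F : Type*} [NormedAddCommGroup F] {x y : F} (s : ℝ)
    (hy : y ≠ x) :
    Tendsto (fun ε : ℝ => (‖y - x‖ ^ 2 + ε ^ 2) ^ s) (𝓝[>] 0) (𝓝 ((‖y - x‖ ^ 2) ^ s)) := by
  have hs : 0 < ‖y - x‖ := norm_pos_iff.2 (sub_ne_zero.2 hy)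
  have h : ContinuousAt (fun ε : ℝ => (‖y - x‖ ^ 2 + ε ^ 2) ^ s) 0 :=
    ContinuousAt.rpow_const (by fun_prop) (Or.inl (by positivity))
  simpa using h.tendsto.mono_left nhdsWithin_le_nhds

variable {E : Type*} [NormedAddCommGroup E] [InnerProductSpace ℝ E] {n : ℕ} {x ξ : E} {g : E → ℝ}

lemma inv_norm_pow_le_radialMajorant (hE : finrank ℝ E = n + 1) {y : E} (hy : ‖y‖ < 1) :
    (‖y‖ ^ n)⁻¹ ≤ radialMajorant E y := by
  have hmem : y ∈ ball (0 : E) 1 := by simpa using hy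
  unfold radialMajorant
  rw [indicator_of_mem hmem, hE, show (1 - (n + 1 : ℕ) : ℝ) = -(n : ℝ) by push_cast; ring,
    Real.rpow_neg (norm_nonneg _), Real.rpow_natCast]
  exact le_add_of_nonneg_right (by positivity)

lemma inv_one_add_norm_pow_le_radialMajorant (hE : finrank ℝ E = n + 1) (y : E) :
    ((1 + ‖y‖) ^ (n + 2))⁻¹ ≤ radialMajorant E y := by
  unfold radialMajorant
  rw [hE, show (-((n + 1 : ℕ) + 1) : ℝ) = -((n + 2 : ℕ) : ℝ) by push_cast; ring,
    Real.rpow_neg (by positivity), Real.rpow_natCast]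
  exact le_add_of_nonneg_left (indicator_nonneg (fun _ _ => by positivity) _)

lemma inv_norm_sub_pow_mul_le_radialMajorant (hn : 2 ≤ n) (hE : finrank ℝ E = n + 1)
    (hx : ‖x‖ = 1) {y : E} (hy : y ≠ 0) (hyx : y ≠ x) :
    (‖y - x‖ ^ n)⁻¹ * (‖y‖ ^ 2)⁻¹
      ≤ 9 * 5 ^ n * (radialMajorant E y + radialMajorant E (y - x)) := by
  have hs : 0 < ‖y - x‖ := norm_pos_iff.2 (sub_ne_zero.2 hyx)
  have ht : 0 < ‖y‖ := norm_pos_iff.2 hy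
  have h1 : ‖y‖ ≤ ‖y - x‖ + 1 := by
    calc ‖y‖ = ‖(y - x) + x‖ := by simp
      _ ≤ _ := by rw [← hx]; exact norm_add_le _ _
  have h2 : 1 ≤ ‖y‖ + ‖y - x‖ := by
    calc 1 = ‖y - (y - x)‖ := by simp [hx]
      _ ≤ _ := norm_sub_le _ _
  have r1 := radialMajorant_nonneg (E := E) y
  have r2 := radialMajorant_nonneg (E := E) (y - x)
  have h5 : (1 : ℝ) ≤ 5 ^ n := one_le_pow₀ (by norm_num)
  rcases lt_or_ge ‖y - x‖ (1 / 2) with h | h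
  · have ht2 : (‖y‖ ^ 2)⁻¹ ≤ 4 := by
      rw [inv_le_comm₀ (by positivity) (by norm_num)]
      nlinarith
    calc (‖y - x‖ ^ n)⁻¹ * (‖y‖ ^ 2)⁻¹ ≤ radialMajorant E (y - x) * 4 :=
          mul_le_mul (inv_norm_pow_le_radialMajorant hE (by linarith)) ht2 (by positivity) r2
      _ ≤ 9 * 5 ^ n * (radialMajorant E y + radialMajorant E (y - x)) := by
          nlinarith [mul_nonneg (sub_nonneg.2 h5) (add_nonneg r1 r2)]
  have hs2 : (‖y - x‖ ^ n)⁻¹ ≤ 2 ^ n := by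
    rw [← inv_pow]
    gcongr
    rw [inv_le_comm₀ hs (by norm_num)]
    linarith
  rcases lt_or_ge ‖y‖ (1 / 2) with h' | h'
  · have ht2 : (‖y‖ ^ 2)⁻¹ ≤ (‖y‖ ^ n)⁻¹ :=
      inv_anti₀ (by positivity) (pow_le_pow_of_le_one ht.le (by linarith) hn)
    calc (‖y - x‖ ^ n)⁻¹ * (‖y‖ ^ 2)⁻¹ ≤ 5 ^ n * radialMajorant E y :=
          mul_le_mul (hs2.trans (by gcongr; norm_num))
            (ht2.trans (inv_norm_pow_le_radialMajorant hE (by linarith)))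
            (by positivity) (by positivity)
      _ ≤ 9 * 5 ^ n * (radialMajorant E y + radialMajorant E (y - x)) := by
          nlinarith [mul_nonneg (zero_le_one.trans h5) r1, mul_nonneg (zero_le_one.trans h5) r2]
  · have a1 : (‖y - x‖ ^ n)⁻¹ ≤ 5 ^ n * ((1 + ‖y‖) ^ n)⁻¹ := by
      rw [← inv_pow, ← inv_pow, ← mul_pow]
      gcongr
      rw [← div_eq_mul_inv, inv_eq_one_div, div_le_div_iff₀ hs (by positivity)]
      linarith
    have a2 : (‖y‖ ^ 2)⁻¹ ≤ 9 * ((1 + ‖y‖) ^ 2)⁻¹ := by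
      rw [← div_eq_mul_inv, inv_eq_one_div, div_le_div_iff₀ (by positivity) (by positivity)]
      nlinarith
    calc (‖y - x‖ ^ n)⁻¹ * (‖y‖ ^ 2)⁻¹
        ≤ (5 ^ n * ((1 + ‖y‖) ^ n)⁻¹) * (9 * ((1 + ‖y‖) ^ 2)⁻¹) :=
          mul_le_mul a1 a2 (by positivity) (by positivity)
      _ = 9 * 5 ^ n * ((1 + ‖y‖) ^ (n + 2))⁻¹ := by rw [pow_add, mul_inv]; ring
      _ ≤ 9 * 5 ^ n * (radialMajorant E y + radialMajorant E (y - x)) := by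
          gcongr
          linarith [inv_one_add_norm_pow_le_radialMajorant hE y]

variable [FiniteDimensional ℝ E] [MeasurableSpace E] [BorelSpace E] {μ : Measure E}
  [μ.IsAddHaarMeasure]

lemma ae_ne_of_finrank_eq_succ (hE : finrank ℝ E = n + 1) (x : E) : ∀ᵐ y ∂μ, y ≠ x := by
  have : Nontrivial E := nontrivial_of_finrank_eq_succ hE
  simp [ae_iff, measure_singleton]

/-- The kernel of the Christoffel criterion is absolutely integrable. -/
lemma integrable_inner_mul_div_norm_sub_pow (hn : 2 ≤ n) (hE : finrank ℝ E = n + 1) (hx : ‖x‖ = 1)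
    (hξ : ‖ξ‖ = 1) (hξx : ⟪ξ, x⟫ = 0) {C : ℝ} (hC : 0 ≤ C) (hg : AEStronglyMeasurable g μ)
    (hgb : ∀ y, y ≠ 0 → |g y| ≤ C * (‖y‖ ^ 2)⁻¹) :
    Integrable (fun y => (-⟪ξ, y⟫ * g y) / ‖x - y‖ ^ (n + 1)) μ := by
  have : Nontrivial E := nontrivial_of_finrank_eq_succ hE
  have hr := integrable_radialMajorant (E := E) (μ := μ)
  refine Integrable.mono' ((hr.add (hr.comp_sub_right x)).const_mul (C * (9 * 5 ^ n))) ?_ ?_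
  · simp_rw [div_eq_mul_inv]
    refine AEStronglyMeasurable.mul (AEStronglyMeasurable.mul ?_ hg) ?_
    · exact (by fun_prop : Continuous fun y : E => -⟪ξ, y⟫).aestronglyMeasurable
    · exact (by fun_prop : Measurable fun y : E => (‖x - y‖ ^ (n + 1))⁻¹).aestronglyMeasurable
  · filter_upwards [ae_ne_of_finrank_eq_succ (μ := μ) hE 0,
      ae_ne_of_finrank_eq_succ (μ := μ) hE x] with y hy hyx
    have hs : 0 < ‖y - x‖ := norm_pos_iff.2 (sub_ne_zero.2 hyx)
    have h1 : |⟪ξ, y⟫| ≤ ‖y - x‖ := by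
      have : ⟪ξ, y⟫ = ⟪ξ, y - x⟫ := by rw [inner_sub_right, hξx, sub_zero]
      rw [this]
      simpa [hξ] using abs_real_inner_le_norm ξ (y - x)
    rw [Real.norm_eq_abs, abs_div, abs_mul, abs_neg, norm_sub_rev x y,
      abs_of_pos (pow_pos hs (n + 1))]
    calc |⟪ξ, y⟫| * |g y| / ‖y - x‖ ^ (n + 1)
        ≤ ‖y - x‖ * (C * (‖y‖ ^ 2)⁻¹) / ‖y - x‖ ^ (n + 1) := by
          gcongr
          exact hgb y hy
      _ = C * ((‖y - x‖ ^ n)⁻¹ * (‖y‖ ^ 2)⁻¹) := by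
          rw [pow_succ]
          field_simp
          ring
      _ ≤ C * (9 * 5 ^ n * (radialMajorant E y + radialMajorant E (y - x))) :=
          mul_le_mul_of_nonneg_left (inv_norm_sub_pow_mul_le_radialMajorant hn hE hx hy hyx) hC
      _ = _ := by simp only [Pi.add_apply]; ring

lemma tendsto_integral_regularised_inner_kernel (hξx : ⟪ξ, x⟫ = 0) (hE : finrank ℝ E = n + 1)
    (hg : AEStronglyMeasurable g μ)
    (hint : Integrable (fun y => (-⟪ξ, y⟫ * g y) / ‖x - y‖ ^ (n + 1)) μ) :
    Tendsto (fun ε : ℝ =>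
        ∫ y, -⟪ξ, y - x⟫ * (‖y - x‖ ^ 2 + ε ^ 2) ^ (-((n + 1) / 2 : ℝ)) * g y ∂μ) (𝓝[>] 0)
      (𝓝 (∫ y, (-⟪ξ, y⟫ * g y) / ‖x - y‖ ^ (n + 1) ∂μ)) := by
  have key : ∀ y, y ≠ x → (-⟪ξ, y⟫ * g y) / ‖x - y‖ ^ (n + 1)
      = -⟪ξ, y - x⟫ * (‖y - x‖ ^ 2) ^ (-((n + 1) / 2 : ℝ)) * g y := by
    intro y hy
    have hs : 0 < ‖y - x‖ := norm_pos_iff.2 (sub_ne_zero.2 hy)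
    have : (‖y - x‖ ^ 2) ^ (-((n + 1) / 2 : ℝ)) = (‖x - y‖ ^ (n + 1))⁻¹ := by
      rw [norm_sub_rev x y, ← Real.rpow_natCast, ← Real.rpow_mul hs.le, ← Real.rpow_natCast,
        ← Real.rpow_neg hs.le]
      congr 1
      push_cast
      ring
    rw [this, inner_sub_right, hξx, sub_zero, div_eq_mul_inv]
    ring
  refine tendsto_integral_filter_of_dominated_convergence
    (fun y => ‖(-⟪ξ, y⟫ * g y) / ‖x - y‖ ^ (n + 1)‖) ?_ ?_ hint.norm ?_
  · refine Eventually.of_forall fun ε =>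
      AEStronglyMeasurable.mul (Measurable.aestronglyMeasurable ?_) hg
    have : Measurable fun y : E => ⟪ξ, y - x⟫ := (by fun_prop : Continuous _).measurable
    fun_prop
  · filter_upwards [self_mem_nhdsWithin] with ε (hε : 0 < ε)
    filter_upwards [ae_ne_of_finrank_eq_succ (μ := μ) hE x] with y hyx
    have hs : 0 < ‖y - x‖ := norm_pos_iff.2 (sub_ne_zero.2 hyx)
    rw [key y hyx, norm_mul, norm_mul, norm_mul, norm_mul]
    gcongr ?_ * ?_ * ?_
    rw [Real.norm_of_nonneg (by positivity), Real.norm_of_nonneg (by positivity)]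
    refine Real.rpow_le_rpow_of_nonpos (by positivity) (by nlinarith) ?_
    have : (0 : ℝ) ≤ n := n.cast_nonneg
    linarith
  · filter_upwards [ae_ne_of_finrank_eq_succ (μ := μ) hE x] with y hyx
    rw [key y hyx]
    exact ((tendsto_regularised_norm_rpow _ hyx).const_mul _).mul_const _

lemma integrable_one_add_norm_sq_rpow (hE : finrank ℝ E = n + 1) :
    Integrable (fun z : E => (1 + ‖z‖ ^ 2) ^ (-((n + 3) / 2 : ℝ))) μ := by
  have := integrable_rpow_neg_one_add_norm_sq (E := E) (μ := μ) (r := n + 3)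
    (by rw [hE]; push_cast; linarith)
  rwa [neg_div] at this

lemma integral_one_add_norm_sq_rpow_pos (hE : finrank ℝ E = n + 1) :
    0 < ∫ z : E, (1 + ‖z‖ ^ 2) ^ (-((n + 3) / 2 : ℝ)) ∂μ := by
  have hc : Continuous fun z : E => (1 + ‖z‖ ^ 2) ^ (-((n + 3) / 2 : ℝ)) :=
    Continuous.rpow_const (by fun_prop) fun z => Or.inl (by positivity)
  exact integral_pos_of_integrable_nonneg_nonzero (x := 0) hc
    (integrable_one_add_norm_sq_rpow hE) (fun z => by positivity) (by simp)

/-- The kernels `ε ^ 2 * (‖y - x‖ ^ 2 + ε ^ 2) ^ (-(n + 3) / 2)` are an approximate identity, up to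
a positive constant, also for functions with an integrable singularity at the origin. -/
lemma tendsto_integral_regularised_kernel (hn : 2 ≤ n) (hE : finrank ℝ E = n + 1) (hx : ‖x‖ = 1)
    {v : E → ℝ} (hv : Measurable v) (hvx : ContinuousAt v x)
    (hvb : ∃ C, 0 ≤ C ∧ ∀ y, y ≠ 0 → |v y| ≤ C * ‖y‖⁻¹) :
    Tendsto (fun ε : ℝ =>
        ∫ y, ε ^ 2 * (‖y - x‖ ^ 2 + ε ^ 2) ^ (-((n + 3) / 2 : ℝ)) * v y ∂μ) (𝓝[>] 0)
      (𝓝 ((∫ z, (1 + ‖z‖ ^ 2) ^ (-((n + 3) / 2 : ℝ)) ∂μ) * v x)) := by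
  have : Nontrivial E := nontrivial_of_finrank_eq_succ hE
  have hn0 : (0 : ℝ) ≤ n := n.cast_nonneg
  obtain ⟨C, hC, hvb⟩ := hvb
  set S : Set E := ball 0 (1 / 2) with hS
  have hSm : MeasurableSet S := measurableSet_ball
  have hxS : x ∈ Sᶜ := by simp only [hS, mem_compl_iff, mem_ball_zero_iff, hx]; norm_num
  -- The contribution near the origin
  have hwint : Integrable (S.indicator v) μ := by
    refine Integrable.mono' ((integrable_radialMajorant (E := E) (μ := μ)).const_mul C)
      (hv.indicator hSm).aestronglyMeasurable ?_
    filter_upwards [ae_ne_of_finrank_eq_succ (μ := μ) hE 0] with y hy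
    have hy' : 0 < ‖y‖ := norm_pos_iff.2 hy
    by_cases hyS : y ∈ S
    · have hyn : ‖y‖ < 1 / 2 := by simpa [hS] using hyS
      rw [indicator_of_mem hyS]
      refine (hvb y hy).trans (mul_le_mul_of_nonneg_left ?_ hC)
      refine le_trans ?_ (inv_norm_pow_le_radialMajorant hE (by linarith))
      refine inv_anti₀ (by positivity) ?_
      simpa using pow_le_pow_of_le_one hy'.le (by linarith) (by omega : 1 ≤ n)
    · rw [indicator_of_notMem hyS, norm_zero]
      exact mul_nonneg hC (radialMajorant_nonneg y)
  have hkm : ∀ ε : ℝ, Measurable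
      fun y : E => ε ^ 2 * (‖y - x‖ ^ 2 + ε ^ 2) ^ (-((n + 3) / 2 : ℝ)) :=
    fun ε => by fun_prop
  have hkS : ∀ ε : ℝ, ∀ y ∈ S, ε ^ 2 * (‖y - x‖ ^ 2 + ε ^ 2) ^ (-((n + 3) / 2 : ℝ))
      ≤ ε ^ 2 * (1 / 4) ^ (-((n + 3) / 2 : ℝ)) := by
    intro ε y hy
    have hyn : ‖y‖ < 1 / 2 := by simpa [hS] using hy
    have h2 : 1 ≤ ‖y‖ + ‖y - x‖ := by
      calc 1 = ‖y - (y - x)‖ := by simp [hx]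
        _ ≤ _ := norm_sub_le _ _
    refine mul_le_mul_of_nonneg_left ?_ (sq_nonneg ε)
    refine Real.rpow_le_rpow_of_nonpos (by norm_num) (by nlinarith [sq_nonneg ε]) (by linarith)
  have hkw : ∀ ε : ℝ, ∀ y, ‖ε ^ 2 * (‖y - x‖ ^ 2 + ε ^ 2) ^ (-((n + 3) / 2 : ℝ)) * S.indicator v y‖
      ≤ ε ^ 2 * ((1 / 4) ^ (-((n + 3) / 2 : ℝ)) * ‖S.indicator v y‖) := by
    intro ε y
    by_cases hyS : y ∈ S
    · rw [norm_mul, Real.norm_of_nonneg (by positivity), ← mul_assoc]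
      exact mul_le_mul_of_nonneg_right (hkS ε y hyS) (norm_nonneg _)
    · rw [indicator_of_notMem hyS, mul_zero, norm_zero, mul_zero, mul_zero]
  have hwi : ∀ ε : ℝ, Integrable (fun y => ε ^ 2 * (‖y - x‖ ^ 2 + ε ^ 2) ^ (-((n + 3) / 2 : ℝ)) *
      S.indicator v y) μ := fun ε =>
    Integrable.mono' ((hwint.norm.const_mul _).const_mul (ε ^ 2))
      ((hkm ε).aestronglyMeasurable.mul (hv.indicator hSm).aestronglyMeasurable)
      (Eventually.of_forall (hkw ε))
  have hw : Tendsto (fun ε : ℝ => ∫ y, ε ^ 2 * (‖y - x‖ ^ 2 + ε ^ 2) ^ (-((n + 3) / 2 : ℝ)) *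
      S.indicator v y ∂μ) (𝓝[>] 0) (𝓝 0) := by
    have hlim : Tendsto (fun ε : ℝ => ε ^ 2 * ∫ y, (1 / 4) ^ (-((n + 3) / 2 : ℝ)) *
        ‖S.indicator v y‖ ∂μ) (𝓝[>] 0) (𝓝 0) := by
      have : ContinuousAt (fun ε : ℝ => ε ^ 2 * ∫ y, (1 / 4) ^ (-((n + 3) / 2 : ℝ)) *
        ‖S.indicator v y‖ ∂μ) 0 := by fun_prop
      simpa using this.tendsto.mono_left nhdsWithin_le_nhds
    refine squeeze_zero_norm (fun ε => ?_) hlim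
    rw [← integral_const_mul]
    exact norm_integral_le_of_norm_le ((hwint.norm.const_mul _).const_mul _)
      (Eventually.of_forall (hkw ε))
  -- The contribution away from the origin
  set b : E → ℝ := Sᶜ.indicator v with hb
  have hbm : Measurable b := hv.indicator hSm.compl
  have hbb : ∀ y, ‖b y‖ ≤ 2 * C := by
    intro y
    by_cases hyS : y ∈ S
    · rw [hb, indicator_of_notMem (by simpa using hyS), norm_zero]
      positivity
    · have hyn : 1 / 2 ≤ ‖y‖ := by simpa [hS] using hyS
      rw [hb, indicator_of_mem hyS]
      refine (hvb y (norm_pos_iff.1 (by linarith))).trans ?_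
      rw [mul_comm 2 C]
      gcongr
      rw [inv_le_comm₀ (by linarith) two_pos]
      linarith
  have hbx : b x = v x := indicator_of_mem hxS v
  have hbc : ContinuousAt b x := by
    refine hvx.congr ?_
    have : (closedBall (0 : E) (1 / 2))ᶜ ∈ 𝓝 x :=
      isClosed_closedBall.isOpen_compl.mem_nhds (by simp [hx]; norm_num)
    filter_upwards [this] with y hy
    rw [hb, indicator_of_mem]
    exact fun h => hy (ball_subset_closedBall h)
  have hker := integrable_one_add_norm_sq_rpow (μ := μ) hE
  have hscale : ∀ ε : ℝ, 0 < ε → ∀ z : E,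
      ε ^ 2 * (‖ε • z‖ ^ 2 + ε ^ 2) ^ (-((n + 3) / 2 : ℝ))
        = (ε ^ (n + 1))⁻¹ * (1 + ‖z‖ ^ 2) ^ (-((n + 3) / 2 : ℝ)) := by
    intro ε hε z
    have e1 : ‖ε • z‖ ^ 2 + ε ^ 2 = ε ^ 2 * (1 + ‖z‖ ^ 2) := by
      rw [norm_smul, Real.norm_of_nonneg hε.le]
      ring
    have e2 : (ε ^ 2) ^ (-((n + 3) / 2 : ℝ)) = (ε ^ (n + 3))⁻¹ := by
      rw [← Real.rpow_natCast, ← Real.rpow_mul hε.le, ← Real.rpow_natCast, ← Real.rpow_neg hε.le]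
      congr 1
      push_cast
      ring
    rw [e1, Real.mul_rpow (by positivity) (by positivity), e2, ← mul_assoc]
    congr 1
    field_simp
    ring
  have hbe : ∀ ε : ℝ, 0 < ε →
      ∫ y, ε ^ 2 * (‖y - x‖ ^ 2 + ε ^ 2) ^ (-((n + 3) / 2 : ℝ)) * b y ∂μ
        = ∫ z, (1 + ‖z‖ ^ 2) ^ (-((n + 3) / 2 : ℝ)) * b (x + ε • z) ∂μ := by
    intro ε hε
    rw [← integral_add_right_eq_self _ x]
    have := Measure.integral_comp_smul_of_nonneg μ (fun y => ε ^ 2 * (‖y‖ ^ 2 + ε ^ 2) ^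
      (-((n + 3) / 2 : ℝ)) * b (x + y)) ε (hR := hε.le)
    simp_rw [hscale ε hε, mul_assoc, integral_const_mul, hE, smul_eq_mul] at this
    have h := mul_left_cancel₀ (inv_ne_zero (pow_ne_zero _ hε.ne')) this
    rw [h, ← integral_const_mul]
    simp [mul_assoc, add_comm x]
  have hbi : ∀ ε : ℝ, 0 < ε →
      Integrable (fun y => ε ^ 2 * (‖y - x‖ ^ 2 + ε ^ 2) ^ (-((n + 3) / 2 : ℝ)) * b y) μ := by
    intro ε hε
    have h1 : Integrable (fun y : E => ε ^ 2 * (‖y‖ ^ 2 + ε ^ 2) ^ (-((n + 3) / 2 : ℝ))) μ := by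
      rw [← integrable_comp_smul_iff μ _ hε.ne']
      simp_rw [hscale ε hε]
      exact hker.const_mul _
    exact (h1.comp_sub_right x).mul_bdd hbm.aestronglyMeasurable (Eventually.of_forall hbb)
  have hblim : Tendsto (fun ε : ℝ => ∫ z, (1 + ‖z‖ ^ 2) ^ (-((n + 3) / 2 : ℝ)) * b (x + ε • z) ∂μ)
      (𝓝[>] 0) (𝓝 (∫ z, (1 + ‖z‖ ^ 2) ^ (-((n + 3) / 2 : ℝ)) * b x ∂μ)) := by
    refine tendsto_integral_filter_of_dominated_convergence
      (fun z => (1 + ‖z‖ ^ 2) ^ (-((n + 3) / 2 : ℝ)) * (2 * C)) ?_ ?_ (hker.mul_const _) ?_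
    · refine Eventually.of_forall fun ε => hker.aestronglyMeasurable.mul ?_
      exact (hbm.comp (by fun_prop : Measurable fun z : E => x + ε • z)).aestronglyMeasurable
    · refine Eventually.of_forall fun ε => Eventually.of_forall fun z => ?_
      rw [norm_mul, Real.norm_of_nonneg (by positivity)]
      exact mul_le_mul_of_nonneg_left (hbb _) (by positivity)
    · refine Eventually.of_forall fun z => Tendsto.const_mul _ ?_
      have h1 : Tendsto (fun ε : ℝ => x + ε • z) (𝓝[>] 0) (𝓝 x) := by
        have : ContinuousAt (fun ε : ℝ => x + ε • z) 0 := by fun_prop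
        simpa using this.tendsto.mono_left nhdsWithin_le_nhds
      exact hbc.tendsto.comp h1
  rw [integral_mul_const, hbx] at hblim
  have hsum := hw.add hblim
  rw [zero_add] at hsum
  refine hsum.congr' ?_
  filter_upwards [self_mem_nhdsWithin] with ε (hε : 0 < ε)
  rw [← hbe ε hε, ← integral_add (hwi ε) (hbi ε hε)]
  refine integral_congr_ae (Eventually.of_forall fun y => ?_)
  simp only [hb, ← mul_add, indicator_self_add_compl_apply]

end Limit

/-! ### Convexity of functions which are homogeneous of degree one -/

section Convexity

open Filter Topology Module

variable {E : Type*} [NormedAddCommGroup E] [InnerProductSpace ℝ E] {u : E → ℝ}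

lemma hasDerivAt_comp_add_smul {g : E → ℝ} (hg : DifferentiableOn ℝ g {0}ᶜ) {a w : E} {t : ℝ}
    (h : a + t • w ≠ 0) :
    HasDerivAt (fun τ : ℝ => g (a + τ • w)) (fderiv ℝ g (a + t • w) w) t := by
  have hl : HasDerivAt (fun τ : ℝ => a + τ • w) w t := by
    simpa using ((hasDerivAt_id t).smul_const w).const_add a
  exact (hg.differentiableAt (isOpen_compl_singleton.mem_nhds h)).hasFDerivAt.comp_hasDerivAt t hl

lemma ConvexOn.fderiv_fderiv_apply_nonneg (hu : ConvexOn ℝ univ u)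
    (hc : ContDiffOn ℝ 2 u {0}ᶜ) {x ξ : E} (hx : ‖x‖ = 1) (hξx : ⟪ξ, x⟫ = 0) :
    0 ≤ fderiv ℝ (fun z => fderiv ℝ u z ξ) x ξ := by
  have hne : ∀ t : ℝ, x + t • ξ ≠ 0 := by
    intro t h
    have h1 : ⟪x + t • ξ, x⟫ = 1 := by
      rw [inner_add_left, real_inner_smul_left, hξx, real_inner_self_eq_norm_sq, hx]
      norm_num
    rw [h, inner_zero_left] at h1
    exact zero_ne_one h1
  have hd1 : ∀ t : ℝ, HasDerivAt (fun τ : ℝ => u (x + τ • ξ)) (fderiv ℝ u (x + t • ξ) ξ) t :=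
    fun t => hasDerivAt_comp_add_smul (hc.differentiableOn two_ne_zero) (hne t)
  have hd2 := hasDerivAt_comp_add_smul (t := 0) ((hc.fderiv_apply_compl_singleton (k := 2) (m := 1)
    (by norm_num) ξ).differentiableOn one_ne_zero) (hne 0)
  have hconv : ConvexOn ℝ univ fun τ : ℝ => u (x + τ • ξ) := by
    have := hu.comp_affineMap (AffineMap.lineMap x (x + ξ) : ℝ →ᵃ[ℝ] E)
    refine this.congr fun τ _ => ?_
    simp [AffineMap.lineMap_apply, add_comm]
  have hmono := hconv.monotoneOn_deriv fun t _ => (hd1 t).differentiableAt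
  rw [funext fun t => (hd1 t).deriv, monotoneOn_univ] at hmono
  have := hmono.deriv_nonneg (x := 0)
  rw [hd2.deriv] at this
  simpa using this

lemma PosHomogeneous.fderiv_apply_self {g : E → ℝ} (hg : PosHomogeneous 0 g)
    (hd : DifferentiableOn ℝ g {0}ᶜ) {y : E} (hy : y ≠ 0) : fderiv ℝ g y y = 0 := by
  have h1 := hasDerivAt_comp_add_smul (a := 0) (w := y) (t := 1) hd (by simpa using hy)
  have h2 : HasDerivAt (fun τ : ℝ => g (0 + τ • y)) 0 1 := by
    refine (hasDerivAt_const (1 : ℝ) (g y)).congr_of_eventuallyEq ?_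
    filter_upwards [lt_mem_nhds one_pos] with τ hτ
    rw [zero_add, hg τ hτ y hy, Real.rpow_zero, one_smul]
  simpa using h1.unique h2

lemma fderiv_fderiv_apply_nonneg_of_sphere (hhom : PosHomogeneous 1 u)
    (hc : ContDiffOn ℝ 2 u {0}ᶜ)
    (hs : ∀ x ∈ sphere (0 : E) 1, ∀ ξ : E, ‖ξ‖ = 1 → ⟪ξ, x⟫ = 0 →
      0 ≤ fderiv ℝ (fun z => fderiv ℝ u z ξ) x ξ) {y : E} (hy : y ≠ 0) (w : E) :
    0 ≤ fderiv ℝ (fun z => fderiv ℝ u z w) y w := by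
  have hy' : 0 < ‖y‖ := norm_pos_iff.2 hy
  have hd : ∀ v : E, DifferentiableOn ℝ (fun z => fderiv ℝ u z v) {0}ᶜ := fun v =>
    (hc.fderiv_apply_compl_singleton (k := 2) (m := 1) (by norm_num) v).differentiableOn one_ne_zero
  have hh : ∀ v : E, PosHomogeneous 0 fun z => fderiv ℝ u z v := fun v => by
    simpa using hhom.posHomogeneous_fderiv_apply (hc.differentiableOn two_ne_zero) v
  have hsymm := fderiv_fderiv_apply_comm (hc.contDiffAt (isOpen_compl_singleton.mem_nhds hy))
  set α := ⟪y, w⟫ / ‖y‖ ^ 2 with hα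
  set η := w - α • y with hη
  have hw : w = α • y + η := by simp [hη]
  have hηy : ⟪η, y⟫ = 0 := by
    rw [hη, inner_sub_left, real_inner_smul_left, real_inner_self_eq_norm_sq, hα,
      real_inner_comm]
    field_simp
    ring
  have hred : ∀ v, fderiv ℝ (fun z => fderiv ℝ u z v) y w
      = fderiv ℝ (fun z => fderiv ℝ u z v) y η := by
    intro v
    conv_lhs => rw [hw]
    rw [map_add, map_smul, (hh v).fderiv_apply_self (hd v) hy, smul_zero, zero_add]
  rw [hred, hsymm, hred]
  rcases eq_or_ne η 0 with h0 | h0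
  · rw [h0, map_zero]
  have hη' : 0 < ‖η‖ := norm_pos_iff.2 h0
  set ξ := ‖η‖⁻¹ • η with hξ
  have hηξ : η = ‖η‖ • ξ := by rw [hξ, smul_inv_smul₀ hη'.ne']
  have hred' : ∀ v, fderiv ℝ (fun z => fderiv ℝ u z v) y η
      = ‖η‖ * fderiv ℝ (fun z => fderiv ℝ u z v) y ξ := by
    intro v
    conv_lhs => rw [hηξ]
    rw [map_smul, smul_eq_mul]
  rw [hred', hsymm, hred', ((hh ξ).posHomogeneous_fderiv_apply (hd ξ) ξ).eq_norm_rpow_smul hy]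
  have := hs (‖y‖⁻¹ • y) (by simp [norm_smul, hy'.ne']) ξ (by simp [hξ, norm_smul, hη'.ne'])
    (by rw [hξ, real_inner_smul_left, real_inner_smul_right, hηy, mul_zero, mul_zero])
  rw [smul_eq_mul]
  positivity

lemma convexOn_univ_of_fderiv_fderiv_apply_nonneg (hE : 3 ≤ finrank ℝ E) (hu : Continuous u)
    (hc : ContDiffOn ℝ 2 u {0}ᶜ)
    (hs : ∀ y : E, y ≠ 0 → ∀ w, 0 ≤ fderiv ℝ (fun z => fderiv ℝ u z w) y w) :
    ConvexOn ℝ univ u := by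
  have : FiniteDimensional ℝ E := Module.finite_of_finrank_pos (by omega)
  refine ⟨convex_univ, fun a _ b _ s t hs0 ht0 hst => ?_⟩
  obtain ⟨e, he0, hea, heb⟩ : ∃ e : E, e ≠ 0 ∧ ⟪e, a⟫ = 0 ∧ ⟪e, b⟫ = 0 := by
    have hlt : finrank ℝ (Submodule.span ℝ ({a, b} : Set E)) < finrank ℝ E := by
      classical
      have h := finrank_span_finset_le_card (R := ℝ) ({a, b} : Finset E)
      rw [Finset.coe_pair] at h
      have : Finset.card {a, b} ≤ 2 := Finset.card_le_two
      exact (h.trans this).trans_lt hE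
    have hne : (Submodule.span ℝ ({a, b} : Set E))ᗮ ≠ ⊥ := by
      intro h
      have := Submodule.finrank_add_finrank_orthogonal (Submodule.span ℝ ({a, b} : Set E))
      rw [h, finrank_bot] at this
      omega
    obtain ⟨e, he, he0⟩ := Submodule.exists_mem_ne_zero_of_ne_bot hne
    refine ⟨e, he0, ?_, ?_⟩
    · exact Submodule.inner_left_of_mem_orthogonal (Submodule.subset_span (by simp)) he
    · exact Submodule.inner_left_of_mem_orthogonal (Submodule.subset_span (by simp)) he
  have key : ∀ δ : ℝ, δ ≠ 0 →
      u (s • a + t • b + δ • e) ≤ s * u (a + δ • e) + t * u (b + δ • e) := by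
    intro δ hδ
    have hne : ∀ τ : ℝ, (a + δ • e) + τ • (b - a) ≠ 0 := by
      intro τ h
      have h1 : ⟪e, (a + δ • e) + τ • (b - a)⟫ = δ * ‖e‖ ^ 2 := by
        simp only [inner_add_right, inner_smul_right, inner_sub_right, hea, heb,
          real_inner_self_eq_norm_sq]
        ring
      rw [h, inner_zero_right] at h1
      exact mul_ne_zero hδ (pow_ne_zero 2 (norm_ne_zero_iff.2 he0)) h1.symm
    have hd1 := fun τ => hasDerivAt_comp_add_smul (hc.differentiableOn two_ne_zero) (hne τ)
    have hd2 := fun τ => hasDerivAt_comp_add_smul ((hc.fderiv_apply_compl_singleton (k := 2)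
      (m := 1) (by norm_num) (b - a)).differentiableOn one_ne_zero) (hne τ)
    have hderiv := funext fun τ => (hd1 τ).deriv
    have hconv : ConvexOn ℝ univ fun τ : ℝ => u ((a + δ • e) + τ • (b - a)) := by
      refine convexOn_univ_of_deriv2_nonneg (fun τ => (hd1 τ).differentiableAt) ?_ fun τ => ?_
      · rw [hderiv]
        exact fun τ => (hd2 τ).differentiableAt
      · rw [Function.iterate_succ_apply, Function.iterate_one, hderiv, (hd2 τ).deriv]
        exact hs _ (hne τ) _
    have := hconv.2 (mem_univ (0 : ℝ)) (mem_univ (1 : ℝ)) hs0 ht0 hst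
    have e1 : s • a + t • b + δ • e = (a + δ • e) + (s • (0 : ℝ) + t • (1 : ℝ)) • (b - a) := by
      obtain rfl : s = 1 - t := by linarith
      simp only [smul_eq_mul]
      module
    have e2 : b + δ • e = (a + δ • e) + (1 : ℝ) • (b - a) := by module
    rw [e1, e2]
    simpa using this
  have hl : ∀ p : E, Tendsto (fun δ : ℝ => u (p + δ • e)) (𝓝[≠] 0) (𝓝 (u p)) := by
    intro p
    have : Continuous fun δ : ℝ => u (p + δ • e) := by fun_prop
    simpa using (this.tendsto 0).mono_left nhdsWithin_le_nhds
  simp only [smul_eq_mul]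
  exact le_of_tendsto_of_tendsto (hl _) (((hl a).const_mul s).add ((hl b).const_mul t))
    (by filter_upwards [self_mem_nhdsWithin] with δ hδ using key δ hδ)

end Convexity

/-! ### The convexity criterion -/

section Christoffel

open Filter Topology Module

variable {n : ℕ} {f u : EuclideanSpace ℝ (Fin (n + 1)) → ℝ}

/-- The kernel of the criterion represents the second derivatives of a solution, up to a positive
constant. -/
theorem integral_inner_mul_fderiv_div_eq (hn : 2 ≤ n) {x ξ : EuclideanSpace ℝ (Fin (n + 1))}
    (hu : PosHomogeneous 1 u) (hc : ContDiffOn ℝ 2 u {0}ᶜ)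
    (hf : HasPowerBounds (-1) f) (hlap : ∀ y, y ≠ 0 → laplacian u y = f y)
    (hx : ‖x‖ = 1) (hξx : ⟪ξ, x⟫ = 0)
    (hint : Integrable fun y => (-⟪ξ, y⟫ * fderiv ℝ f y ξ) / ‖x - y‖ ^ (n + 1)) :
    ∫ y, (-⟪ξ, y⟫ * fderiv ℝ f y ξ) / ‖x - y‖ ^ (n + 1)
      = (n + 1) * ((∫ z : EuclideanSpace ℝ (Fin (n + 1)), (1 + ‖z‖ ^ 2) ^ (-((n + 3) / 2 : ℝ))) *
          fderiv ℝ (fun z => fderiv ℝ u z ξ) x ξ) := by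
  have hE : finrank ℝ (EuclideanSpace ℝ (Fin (n + 1))) = n + 1 := by simp
  have hd1 : ∀ v, ContDiffOn ℝ 1 (fun y => fderiv ℝ u y v) {0}ᶜ := fun v =>
    hc.fderiv_apply_compl_singleton (k := 2) (m := 1) (by norm_num) v
  have hd2 : ContinuousOn (fun y => fderiv ℝ (fun z => fderiv ℝ u z ξ) y ξ) {0}ᶜ :=
    ((hd1 ξ).fderiv_apply_compl_singleton (k := 1) (m := 0) (by norm_num) ξ).continuousOn
  have hh1 : ∀ v, PosHomogeneous 0 fun y => fderiv ℝ u y v := fun v => by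
    simpa using hu.posHomogeneous_fderiv_apply (hc.differentiableOn two_ne_zero) v
  have hh2 := (hh1 ξ).posHomogeneous_fderiv_apply ((hd1 ξ).differentiableOn one_ne_zero) ξ
  have hx0 : x ≠ 0 := norm_ne_zero_iff.1 (by rw [hx]; exact one_ne_zero)
  obtain ⟨C, hC, hb⟩ := hh2.exists_bound hd2
  have hR := (tendsto_integral_regularised_kernel (μ := volume) hn hE hx
    (measurable_fderiv_apply_const ℝ (fun z => fderiv ℝ u z ξ) ξ)
    (hd2.continuousAt (isOpen_compl_singleton.mem_nhds hx0))
    ⟨C, hC, fun y hy => by simpa [Real.rpow_neg_one] using hb y hy⟩).const_mul (n + 1 : ℝ)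
  have hL := tendsto_integral_regularised_inner_kernel (μ := volume) hξx hE
    (measurable_fderiv_apply_const ℝ f ξ).aestronglyMeasurable hint
  refine tendsto_nhds_unique (hL.congr' ?_) hR
  filter_upwards [self_mem_nhdsWithin] with ε hε
  exact integral_regularised_kernel_mul_fderiv hn hε x ξ
    (hu.hasPowerBounds (hc.of_le (by norm_num)))
    (fun v => (hh1 v).hasPowerBounds (hd1 v)) hf hlap

end Christoffel

/-- the Christoffel problem convexity criterion via the fundamental solution. -/
theorem stmt_0 (n : ℕ) (hn : 2 ≤ n)
    (f u : EuclideanSpace ℝ (Fin (n + 1)) → ℝ) (K : NNReal)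
    (hf_pos : ∀ x ∈ sphere (0 : EuclideanSpace ℝ (Fin (n + 1))) 1, 0 < f x)
    (hf_lip : LipschitzOnWith K f (sphere (0 : EuclideanSpace ℝ (Fin (n + 1))) 1))
    (hf_hom : ∀ t : ℝ, 0 < t → ∀ y : EuclideanSpace ℝ (Fin (n + 1)), y ≠ 0 →
      f (t • y) = t⁻¹ * f y)
    (hu_cont : Continuous u)
    (hu_hom : ∀ t : ℝ, 0 < t → ∀ y : EuclideanSpace ℝ (Fin (n + 1)), y ≠ 0 →
      u (t • y) = t * u y)
    (hu_C2 : ContDiffOn ℝ 2 u {(0 : EuclideanSpace ℝ (Fin (n + 1)))}ᶜ)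
    (hu_lap : ∀ x : EuclideanSpace ℝ (Fin (n + 1)), x ≠ 0 → laplacian u x = f x) :
    (∀ x ∈ sphere (0 : EuclideanSpace ℝ (Fin (n + 1))) 1,
      ∀ ξ : EuclideanSpace ℝ (Fin (n + 1)), ‖ξ‖ = 1 → ⟪ξ, x⟫ = 0 →
        Integrable (fun y : EuclideanSpace ℝ (Fin (n + 1)) =>
          (-⟪ξ, y⟫ * fderiv ℝ f y ξ) / ‖x - y‖ ^ (n + 1)))
    ∧ (ConvexOn ℝ Set.univ u ↔
        ∀ x ∈ sphere (0 : EuclideanSpace ℝ (Fin (n + 1))) 1,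
          ∀ ξ : EuclideanSpace ℝ (Fin (n + 1)), ‖ξ‖ = 1 → ⟪ξ, x⟫ = 0 →
            0 ≤ ∫ y : EuclideanSpace ℝ (Fin (n + 1)),
              (-⟪ξ, y⟫ * fderiv ℝ f y ξ) / ‖x - y‖ ^ (n + 1)) := by
  have hE : Module.finrank ℝ (EuclideanSpace ℝ (Fin (n + 1))) = n + 1 := by simp
  have hf : HasPowerBounds (-1) f := hasPowerBounds_of_homogeneous_neg_one
    (fun t ht y hy => by rw [hf_hom t ht y hy, Real.rpow_neg_one, smul_eq_mul]) hf_lip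
  have hu : PosHomogeneous 1 u := fun t ht y hy => by
    rw [hu_hom t ht y hy, Real.rpow_one, smul_eq_mul]
  have hint : ∀ x ∈ sphere (0 : EuclideanSpace ℝ (Fin (n + 1))) 1,
      ∀ ξ : EuclideanSpace ℝ (Fin (n + 1)), ‖ξ‖ = 1 → ⟪ξ, x⟫ = 0 →
        Integrable (fun y : EuclideanSpace ℝ (Fin (n + 1)) =>
          (-⟪ξ, y⟫ * fderiv ℝ f y ξ) / ‖x - y‖ ^ (n + 1)) := by
    intro x hx ξ hξ hξx
    obtain ⟨C, hC, hb⟩ := hf.exists_fderiv_bound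
    refine integrable_inner_mul_div_norm_sub_pow hn hE (by simpa using hx) hξ hξx hC
      (measurable_fderiv_apply_const ℝ f ξ).aestronglyMeasurable fun y hy => (hb y hy ξ).trans_eq ?_
    rw [hξ, mul_one, ← Real.rpow_natCast, ← Real.rpow_neg (norm_nonneg _)]
    norm_num
  refine ⟨hint, ?_⟩
  have hform := fun x hx ξ hξ hξx => integral_inner_mul_fderiv_div_eq hn hu hu_C2 hf hu_lap
    (mem_sphere_zero_iff_norm.1 hx) hξx (hint x hx ξ hξ hξx)
  constructor
  · intro hconv x hx ξ hξ hξx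
    rw [hform x hx ξ hξ hξx]
    have := hconv.fderiv_fderiv_apply_nonneg hu_C2 (mem_sphere_zero_iff_norm.1 hx) hξx
    exact mul_nonneg (by positivity)
      (mul_nonneg (integral_one_add_norm_sq_rpow_pos hE).le this)
  · intro hI
    refine convexOn_univ_of_fderiv_fderiv_apply_nonneg (by omega) hu_cont hu_C2 fun y hy w =>
      fderiv_fderiv_apply_nonneg_of_sphere hu hu_C2 (fun x hx ξ hξ hξx => ?_) hy w
    have h := hI x hx ξ hξ hξx
    rw [hform x hx ξ hξ hξx, mul_nonneg_iff_of_pos_left (by positivity)] at h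
    exact (mul_nonneg_iff_of_pos_left (integral_one_add_norm_sq_rpow_pos hE)).1 h
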